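/- arXiv:1401.3705 — 6 statements merged into one kernel-verified Lean document; each statement's English description precedes it below -/
import Mathlib

section
/- For every integer i ≥ 0 there exists a unique morphism f_i : P_{-i} → F_{-i} in 𝒜 such that: (1) the composite of f_i with the canonical epimorphism F_{-i} ↠ Gr_{-i} equals the canonical monomorphism P_{-i} ↪ Gr_{-i}; and (2) for every integer s > i, the composite e^s ∘ (F_{-i} ↪ H) ∘ f_i : P_{-i} → H factors through the monomorphism F_{s-1} ↪ H. Moreover, the morphism φ_e : ⊕_{(i,j) : 0 ≤ j ≤ i} P_{-i} → H, whose restriction to the (i,j)-indexed summand is e^j ∘ (F_{-i} ↪ H) ∘ f_i, is an isomorphism, and it is filtered: for every k ∈ ℤ, the restriction of φ_e to the sub-biproduct ⊕_{(i,j) : 0 ≤ j ≤ i, 2j−i ≤ k} P_{-i} factors through the monomorphism F_k ↪ H and induces an isomorphism onto F_k. -/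
open CategoryTheory CategoryTheory.Limits

attribute [local instance] CategoryTheory.Abelian.hasFiniteBiproducts

set_option linter.unusedSectionVars false

universe v u

variable {A : Type u} [Category.{v} A] [Abelian A]

/-- Iterated composite `g^j` of an endomorphism in a category. -/
def cpow {X : A} (g : X ⟶ X) : ℕ → (X ⟶ X)
  | 0 => 𝟙 X
  | (j + 1) => cpow g j ≫ g

variable {H : A}

/-- The graded piece `Gr_n := F_n / F_{n-1}`, as the cokernel of the inclusion
`F_{n-1} ↪ F_n`. -/
noncomputable def GrC (F : ℤ → Subobject H) (hmono : ∀ n : ℤ, F (n - 1) ≤ F n) (n : ℤ) : A :=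
  cokernel (Subobject.ofLE (F (n - 1)) (F n) (hmono n))

/-- The map on graded pieces induced by a filtered endomorphism. -/
noncomputable def grMapC (F : ℤ → Subobject H) (hmono : ∀ n : ℤ, F (n - 1) ≤ F n)
    (g : H ⟶ H) (n m : ℤ)
    (h : (F m).Factors ((F n).arrow ≫ g))
    (h' : (F (m - 1)).Factors ((F (n - 1)).arrow ≫ g)) :
    GrC F hmono n ⟶ GrC F hmono m :=
  cokernel.map _ _ ((F (m - 1)).factorThru _ h') ((F m).factorThru _ h)
    (by rw [← cancel_mono (F m).arrow]; simp)

theorem factors_cpow (F : ℤ → Subobject H) (e : H ⟶ H)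
    (hmaps : ∀ n : ℤ, (F (n + 2)).Factors ((F n).arrow ≫ e)) (j : ℕ) (n : ℤ) :
    (F (n + 2 * j)).Factors ((F n).arrow ≫ cpow e j) := by
  induction j generalizing n with
  | zero =>
    simpa [cpow] using (F n).factors_self
  | succ j ih =>
    have h1 := ih n
    have h2 := hmaps (n + 2 * j)
    push_cast
    rw [show n + 2 * ((j : ℤ) + 1) = n + 2 * j + 2 by ring]
    have : (F n).arrow ≫ cpow e (j + 1) =
        ((F (n + 2 * j)).factorThru _ h1) ≫ ((F (n + 2 * j)).arrow ≫ e) := by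
      simp [cpow]
    rw [this]
    exact Subobject.factors_of_factors_right _ h2

/-- The iterate `ē^j : Gr_n → Gr_{n+2j}`, induced by `e^j`. -/
noncomputable def eBarPowC (F : ℤ → Subobject H) (hmono : ∀ n : ℤ, F (n - 1) ≤ F n)
    (e : H ⟶ H) (hmaps : ∀ n : ℤ, (F (n + 2)).Factors ((F n).arrow ≫ e)) (j : ℕ) (n : ℤ) :
    GrC F hmono n ⟶ GrC F hmono (n + 2 * j) :=
  grMapC F hmono (cpow e j) n (n + 2 * j) (factors_cpow F e hmaps j n)
    (by
      have := factors_cpow F e hmaps j (n - 1)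
      rwa [show n - 1 + 2 * (j : ℤ) = n + 2 * j - 1 by ring] at this)

/-- The primitive part `P_{-i} := ker (ē^{i+1} : Gr_{-i} → Gr_{i+2})`. -/
noncomputable def PrimC (F : ℤ → Subobject H) (hmono : ∀ n : ℤ, F (n - 1) ≤ F n)
    (e : H ⟶ H) (hmaps : ∀ n : ℤ, (F (n + 2)).Factors ((F n).arrow ≫ e)) (i : ℕ) : A :=
  kernel (eBarPowC F hmono e hmaps (i + 1) (-(i : ℤ)))

/-- The index type for the pairs `(i, j)` with `0 ≤ j ≤ i` (truncated at `N`, beyond which all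
the primitive parts are zero, the filtration being finite of amplitude `N`). -/
abbrev IdxC (N : ℕ) := {q : Fin (N + 1) × Fin (N + 1) // (q.2 : ℕ) ≤ (q.1 : ℕ)}

/-- The index type for the pairs `(i, j)` with `0 ≤ j ≤ i` and `2j - i ≤ k`. -/
abbrev IdxCk (N : ℕ) (k : ℤ) :=
  {q : IdxC N // 2 * ((q.1.2 : ℕ) : ℤ) - ((q.1.1 : ℕ) : ℤ) ≤ k}

/-- The morphism `φ_e : ⊕_{(i,j) : 0 ≤ j ≤ i} P_{-i} ⟶ H`, whose restriction to the
`(i,j)`-summand is `e^j ∘ (F_{-i} ↪ H) ∘ f_i`. -/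
noncomputable def phiC (F : ℤ → Subobject H) (hmono : ∀ n : ℤ, F (n - 1) ≤ F n)
    (e : H ⟶ H) (hmaps : ∀ n : ℤ, (F (n + 2)).Factors ((F n).arrow ≫ e)) (N : ℕ)
    (f : ∀ i : ℕ, (PrimC F hmono e hmaps i ⟶ (F (-(i : ℤ)) : A))) :
    (⨁ fun q : IdxC N => PrimC F hmono e hmaps (q.1.1 : ℕ)) ⟶ H :=
  biproduct.desc fun q =>
    f (q.1.1 : ℕ) ≫ (F (-((q.1.1 : ℕ) : ℤ))).arrow ≫ cpow e (q.1.2 : ℕ)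

section SubobjectFactors

variable {T T' : A}

theorem factors_iff_comp_cokernel_eq_zero (S : Subobject H) (x : T ⟶ H) :
    S.Factors x ↔ x ≫ cokernel.π S.arrow = 0 := by
  constructor
  · intro h
    rw [← S.factorThru_arrow x h, Category.assoc, cokernel.condition, comp_zero]
  · intro h
    rw [← Abelian.monoLift_comp S.arrow x h]
    exact S.factors_comp_arrow _

theorem factors_of_epi_comp (S : Subobject H) (p : T' ⟶ T) [Epi p] {x : T ⟶ H}
    (h : S.Factors (p ≫ x)) : S.Factors x := by
  rw [factors_iff_comp_cokernel_eq_zero] at h ⊢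
  rw [← cancel_epi p, ← Category.assoc, h, comp_zero]

theorem factors_sub (S : Subobject H) {x y : T ⟶ H} (hx : S.Factors x) (hy : S.Factors y) :
    S.Factors (x - y) := by
  rw [factors_iff_comp_cokernel_eq_zero] at *
  simp [hx, hy]

theorem factors_sum (S : Subobject H) {ι : Type*} (s : Finset ι) (x : ι → (T ⟶ H))
    (h : ∀ q ∈ s, S.Factors (x q)) : S.Factors (∑ q ∈ s, x q) := by
  simp only [factors_iff_comp_cokernel_eq_zero] at *
  rw [Preadditive.sum_comp]
  exact Finset.sum_eq_zero h

theorem factors_precomp (S : Subobject H) (p : T' ⟶ T) {x : T ⟶ H} (h : S.Factors x) :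
    S.Factors (p ≫ x) :=
  Subobject.factors_of_factors_right _ h

theorem factors_comp_of_arrow {S R : Subobject H} {g : H ⟶ H} (hg : R.Factors (S.arrow ≫ g))
    {x : T ⟶ H} (h : S.Factors x) : R.Factors (x ≫ g) := by
  rw [← S.factorThru_arrow x h, Category.assoc]
  exact factors_precomp _ _ hg

theorem factors_of_biproduct {ι : Type} [Finite ι] {X : ι → A} (S : Subobject H)
    (x : (⨁ X) ⟶ H) (h : ∀ q, S.Factors (biproduct.ι X q ≫ x)) : S.Factors x := by
  rw [factors_iff_comp_cokernel_eq_zero]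
  refine biproduct.hom_ext' _ _ fun q => ?_
  have := h q
  rw [factors_iff_comp_cokernel_eq_zero, Category.assoc] at this
  rw [this, comp_zero]

end SubobjectFactors

theorem cpow_add {X : A} (g : X ⟶ X) (a b : ℕ) : cpow g (a + b) = cpow g a ≫ cpow g b := by
  induction b with
  | zero => simp [cpow]
  | succ b ih => rw [← Nat.add_assoc]; simp [cpow, ih]

theorem mono_biproduct_desc_ι {ι : Type} [Finite ι] (X : ι → A) (p : ι → Prop) :
    Mono (biproduct.desc (f := fun j : Subtype p => X j.1) fun j => biproduct.ι X j.1) := by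
  classical
  have hπ : ∀ j : Subtype p,
      (biproduct.desc (f := fun j : Subtype p => X j.1) fun j => biproduct.ι X j.1) ≫
        biproduct.π X j.1 = biproduct.π (fun j : Subtype p => X j.1) j := by
    intro j
    refine biproduct.hom_ext' _ _ fun i => ?_
    rw [← Category.assoc, biproduct.ι_desc]
    by_cases h : i = j
    · subst h
      simp
    · rw [biproduct.ι_π_ne _ (fun h' => h (Subtype.ext h')), biproduct.ι_π_ne _ h]
  refine Preadditive.mono_of_cancel_zero _ fun g hg => biproduct.hom_ext _ _ fun j => ?_
  rw [← hπ j, ← Category.assoc, hg, zero_comp, zero_comp]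

section Filtration

variable {F : ℤ → Subobject H} {T : A}

theorem filtration_le (hmono : ∀ n : ℤ, F (n - 1) ≤ F n) {m n : ℤ} (h : m ≤ n) : F m ≤ F n := by
  induction n, h using Int.leInduction with
  | base => exact le_rfl
  | succ n _ ih => exact ih.trans (by simpa using hmono (n + 1))

theorem factors_of_index_le (hmono : ∀ n : ℤ, F (n - 1) ≤ F n) {m n : ℤ} (h : m ≤ n)
    {x : T ⟶ H} (hx : (F m).Factors x) : (F n).Factors x :=
  Subobject.factors_of_le x (filtration_le hmono h) hx

theorem factors_comp_cpow {e : H ⟶ H} (hmono : ∀ n : ℤ, F (n - 1) ≤ F n)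
    (hmaps : ∀ n : ℤ, (F (n + 2)).Factors ((F n).arrow ≫ e))
    {n m : ℤ} (j : ℕ) (hm : n + 2 * j ≤ m) {x : T ⟶ H} (hx : (F n).Factors x) :
    (F m).Factors (x ≫ cpow e j) :=
  factors_of_index_le hmono hm (factors_comp_of_arrow (factors_cpow F e hmaps j n) hx)

/-- The canonical epimorphism `F_n ↠ Gr_n`. -/
noncomputable def grπ (hmono : ∀ n : ℤ, F (n - 1) ≤ F n) (n : ℤ) : (F n : A) ⟶ GrC F hmono n :=
  cokernel.π (Subobject.ofLE (F (n - 1)) (F n) (hmono n))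

instance (hmono : ∀ n : ℤ, F (n - 1) ≤ F n) (n : ℤ) : Epi (grπ hmono n) :=
  inferInstanceAs (Epi (cokernel.π _))

theorem ofLE_comp_grπ (hmono : ∀ n : ℤ, F (n - 1) ≤ F n) (n : ℤ) :
    Subobject.ofLE (F (n - 1)) (F n) (hmono n) ≫ grπ hmono n = 0 :=
  cokernel.condition _

/-- The canonical monomorphism `P_{-i} ↪ Gr_{-i}`. -/
noncomputable def primι (hmono : ∀ n : ℤ, F (n - 1) ≤ F n) {e : H ⟶ H}
    (hmaps : ∀ n : ℤ, (F (n + 2)).Factors ((F n).arrow ≫ e)) (i : ℕ) :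
    PrimC F hmono e hmaps i ⟶ GrC F hmono (-(i : ℤ)) :=
  kernel.ι (eBarPowC F hmono e hmaps (i + 1) (-(i : ℤ)))

instance (hmono : ∀ n : ℤ, F (n - 1) ≤ F n) {e : H ⟶ H}
    (hmaps : ∀ n : ℤ, (F (n + 2)).Factors ((F n).arrow ≫ e)) (i : ℕ) :
    Mono (primι hmono hmaps i) :=
  inferInstanceAs (Mono (kernel.ι _))

theorem primι_eBarPowC (hmono : ∀ n : ℤ, F (n - 1) ≤ F n) {e : H ⟶ H}
    (hmaps : ∀ n : ℤ, (F (n + 2)).Factors ((F n).arrow ≫ e)) (i : ℕ) :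
    primι hmono hmaps i ≫ eBarPowC F hmono e hmaps (i + 1) (-(i : ℤ)) = 0 :=
  kernel.condition _

theorem exists_comp_primι (hmono : ∀ n : ℤ, F (n - 1) ≤ F n) {e : H ⟶ H}
    (hmaps : ∀ n : ℤ, (F (n + 2)).Factors ((F n).arrow ≫ e)) (i : ℕ)
    (y : T ⟶ GrC F hmono (-(i : ℤ)))
    (hy : y ≫ eBarPowC F hmono e hmaps (i + 1) (-(i : ℤ)) = 0) :
    ∃ u : T ⟶ PrimC F hmono e hmaps i, u ≫ primι hmono hmaps i = y :=
  ⟨kernel.lift _ y hy, kernel.lift_ι _ y hy⟩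

theorem comp_grπ_eq_zero_iff (hmono : ∀ n : ℤ, F (n - 1) ≤ F n) {n : ℤ}
    (x : T ⟶ (F n : A)) :
    x ≫ grπ hmono n = 0 ↔
      (F (n - 1)).Factors (x ≫ (F n).arrow) := by
  constructor
  · intro h
    rw [← Abelian.monoLift_comp _ x (show x ≫ cokernel.π (Subobject.ofLE _ _ (hmono n)) = 0 from h),
      Category.assoc, Subobject.ofLE_arrow]
    exact Subobject.factors_comp_arrow _
  · intro h
    have : x = (F (n - 1)).factorThru _ h ≫ Subobject.ofLE (F (n - 1)) (F n) (hmono n) := by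
      rw [← cancel_mono (F n).arrow]; simp
    rw [this, Category.assoc, ofLE_comp_grπ, comp_zero]

theorem grπ_eBarPowC (hmono : ∀ n : ℤ, F (n - 1) ≤ F n) {e : H ⟶ H}
    (hmaps : ∀ n : ℤ, (F (n + 2)).Factors ((F n).arrow ≫ e)) (j : ℕ) (n : ℤ) :
    grπ hmono n ≫ eBarPowC F hmono e hmaps j n =
      (F (n + 2 * j)).factorThru _ (factors_cpow F e hmaps j n) ≫
        grπ hmono (n + 2 * j) := by
  exact cokernel.π_desc _ _ _

theorem comp_grπ_eBarPowC_eq_zero_iff (hmono : ∀ n : ℤ, F (n - 1) ≤ F n) {e : H ⟶ H}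
    (hmaps : ∀ n : ℤ, (F (n + 2)).Factors ((F n).arrow ≫ e)) (j : ℕ) {n m : ℤ}
    (hm : n + 2 * j - 1 = m) (x : T ⟶ (F n : A)) :
    (x ≫ grπ hmono n) ≫
        eBarPowC F hmono e hmaps j n = 0 ↔
      (F m).Factors (x ≫ (F n).arrow ≫ cpow e j) := by
  subst hm
  rw [Category.assoc, grπ_eBarPowC, ← Category.assoc, comp_grπ_eq_zero_iff]
  simp

theorem factors_pred_of_isIso_eBarPowC (hmono : ∀ n : ℤ, F (n - 1) ≤ F n) {e : H ⟶ H}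
    (hmaps : ∀ n : ℤ, (F (n + 2)).Factors ((F n).arrow ≫ e)) {j : ℕ} {n m : ℤ}
    (hm : n + 2 * j - 1 = m) (hiso : IsIso (eBarPowC F hmono e hmaps j n))
    {x : T ⟶ H} (hx : (F n).Factors x) (h : (F m).Factors (x ≫ cpow e j)) :
    (F (n - 1)).Factors x := by
  have h1 := (comp_grπ_eBarPowC_eq_zero_iff hmono hmaps j hm ((F n).factorThru x hx)).2
    (by simpa using h)
  have h2 := (comp_grπ_eq_zero_iff hmono _).1 (zero_of_comp_mono _ h1)
  simpa using h2

theorem exists_refinement_of_isIso_eBarPowC (hmono : ∀ n : ℤ, F (n - 1) ≤ F n) {e : H ⟶ H}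
    (hmaps : ∀ n : ℤ, (F (n + 2)).Factors ((F n).arrow ≫ e)) {j : ℕ} {n m : ℤ}
    (hm : n + 2 * j = m) (hiso : IsIso (eBarPowC F hmono e hmaps j n))
    {z : T ⟶ H} (hz : (F m).Factors z) :
    ∃ (T' : A) (p : T' ⟶ T) (_ : Epi p) (y : T' ⟶ H),
      (F n).Factors y ∧ (F (m - 1)).Factors (p ≫ z - y ≫ cpow e j) := by
  subst hm
  obtain ⟨T', p, hp, y, hy⟩ := surjective_up_to_refinements_of_epi
    (grπ hmono n)
    (((F (n + 2 * j)).factorThru z hz ≫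
      grπ hmono (n + 2 * j)) ≫
        inv (eBarPowC F hmono e hmaps j n))
  refine ⟨T', p, hp, y ≫ (F n).arrow, Subobject.factors_comp_arrow _, ?_⟩
  have key := (comp_grπ_eq_zero_iff hmono
    (p ≫ (F (n + 2 * j)).factorThru z hz -
      y ≫ (F (n + 2 * j)).factorThru _ (factors_cpow F e hmaps j n))).1 (by
    have := hy =≫ eBarPowC F hmono e hmaps j n
    simp only [Category.assoc, IsIso.inv_hom_id, Category.comp_id, grπ_eBarPowC] at this
    simp [this])
  simpa using key

theorem exists_primitive (hmono : ∀ n : ℤ, F (n - 1) ≤ F n) {e : H ⟶ H}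
    (hmaps : ∀ n : ℤ, (F (n + 2)).Factors ((F n).arrow ≫ e)) (i : ℕ)
    {f : PrimC F hmono e hmaps i ⟶ (F (-(i : ℤ)) : A)}
    (hf : f ≫ grπ hmono (-(i : ℤ)) =
      primι hmono hmaps i)
    {x : T ⟶ H} (hx : (F (-(i : ℤ))).Factors x)
    (h : (F ((i : ℤ) + 1)).Factors (x ≫ cpow e (i + 1))) :
    ∃ u : T ⟶ PrimC F hmono e hmaps i,
      (F (-(i : ℤ) - 1)).Factors (x - u ≫ f ≫ (F (-(i : ℤ))).arrow) := by
  have h1 := (comp_grπ_eBarPowC_eq_zero_iff hmono hmaps (i + 1) (m := (i : ℤ) + 1)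
    (by push_cast; ring) ((F (-(i : ℤ))).factorThru x hx)).2 (by simpa using h)
  obtain ⟨u, hu⟩ := exists_comp_primι hmono hmaps i _ h1
  refine ⟨u, ?_⟩
  have key := (comp_grπ_eq_zero_iff hmono
    ((F (-(i : ℤ))).factorThru x hx - u ≫ f)).1 (by
      rw [Preadditive.sub_comp, Category.assoc, hf, hu, sub_self])
  simpa using key

/-- In a Lefschetz filtration, a morphism into `F (-i-1)` all of whose images under the powers
`e ^ s`, `s > i`, lie one step lower than expected vanishes. -/
theorem eq_zero_of_factors (hmono : ∀ n : ℤ, F (n - 1) ≤ F n)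
    {N : ℕ} (hbot : ∀ n : ℤ, n ≤ -(N : ℤ) → F n = ⊥) {e : H ⟶ H}
    (hmaps : ∀ n : ℤ, (F (n + 2)).Factors ((F n).arrow ≫ e))
    (hHL : ∀ i : ℕ, IsIso (eBarPowC F hmono e hmaps i (-(i : ℤ)))) (i : ℕ)
    {x : T ⟶ H} (hx : (F (-(i : ℤ) - 1)).Factors x)
    (h : ∀ s : ℕ, i < s → (F ((s : ℤ) - 1)).Factors (x ≫ cpow e s)) : x = 0 := by
  have step : ∀ t : ℕ, (F (-((i + t : ℕ) : ℤ) - 1)).Factors x := by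
    intro t
    induction t with
    | zero => simpa using hx
    | succ t ih =>
      refine factors_pred_of_isIso_eBarPowC hmono hmaps (m := ((i + (t + 1) : ℕ) : ℤ) - 1)
        (by ring) (hHL _) ?_ (h _ (by omega))
      rwa [show -((i + (t + 1) : ℕ) : ℤ) = -((i + t : ℕ) : ℤ) - 1 by push_cast; ring]
  have := step N
  rw [hbot _ (by push_cast; omega)] at this
  exact (Subobject.bot_factors_iff_zero _).1 this

theorem lift_factors_refinement (hmono : ∀ n : ℤ, F (n - 1) ≤ F n) {e : H ⟶ H}
    (hmaps : ∀ n : ℤ, (F (n + 2)).Factors ((F n).arrow ≫ e))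
    (hHL : ∀ i : ℕ, IsIso (eBarPowC F hmono e hmaps i (-(i : ℤ)))) (i t : ℕ) :
    ∃ (T : A) (p : T ⟶ PrimC F hmono e hmaps i) (_ : Epi p) (x : T ⟶ (F (-(i : ℤ)) : A)),
      x ≫ grπ hmono (-(i : ℤ)) =
        p ≫ primι hmono hmaps i ∧
      (∀ s : ℕ, i < s → s ≤ i + t →
        (F ((s : ℤ) - 1)).Factors (x ≫ (F (-(i : ℤ))).arrow ≫ cpow e s)) := by
  induction t with
  | zero =>
    obtain ⟨T, p, hp, x, hx⟩ := surjective_up_to_refinements_of_epi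
      (grπ hmono (-(i : ℤ)))
      (primι hmono hmaps i)
    exact ⟨T, p, hp, x, hx.symm, fun s h1 h2 => absurd h1 (by omega)⟩
  | succ t ih =>
    obtain ⟨T, p, hp, x, hx, hs⟩ := ih
    have htop : (F ((i + t + 1 : ℕ) : ℤ)).Factors
        ((x ≫ (F (-(i : ℤ))).arrow) ≫ cpow e (i + t + 1)) := by
      rcases Nat.eq_zero_or_pos t with rfl | ht
      · rw [Category.assoc]
        refine (comp_grπ_eBarPowC_eq_zero_iff hmono hmaps (i + 1) (by push_cast; ring) x).1 ?_
        rw [hx, Category.assoc, primι_eBarPowC, comp_zero]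
      · have h1 := hs (i + t) (by omega) le_rfl
        have h2 := factors_comp_cpow hmono hmaps 1
          (m := ((i + t + 1 : ℕ) : ℤ)) (by push_cast; omega) h1
        simpa only [Category.assoc, cpow_add e (i + t) 1] using h2
    obtain ⟨T', p', hp', y, hy, hxy⟩ := exists_refinement_of_isIso_eBarPowC hmono hmaps
      (j := i + t + 1) (by ring) (hHL (i + t + 1)) htop
    have hy1 : (F (-(i : ℤ) - 1)).Factors y :=
      factors_of_index_le hmono (by push_cast; omega) hy
    have hy0 : (F (-(i : ℤ))).Factors y := factors_of_index_le hmono (by omega) hy1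
    refine ⟨T', p' ≫ p, epi_comp _ _, p' ≫ x - (F (-(i : ℤ))).factorThru y hy0, ?_, ?_⟩
    · rw [Preadditive.sub_comp, (comp_grπ_eq_zero_iff hmono ((F (-(i : ℤ))).factorThru y hy0)).2
        (by simpa using hy1), sub_zero, Category.assoc, hx, Category.assoc]
    · intro s his hst
      rcases Nat.lt_or_ge (i + t) s with h | h
      · obtain rfl : s = i + t + 1 := by omega
        simpa using hxy
      · have h1 := factors_precomp _ p' (hs s his h)
        have h2 : (F ((s : ℤ) - 1)).Factors (y ≫ cpow e s) :=
          factors_comp_cpow hmono hmaps s (by push_cast; omega) hy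
        simpa using factors_sub _ h1 h2

theorem existsUnique_primitive_lift_s0 (hmono : ∀ n : ℤ, F (n - 1) ≤ F n)
    {N : ℕ} (hbot : ∀ n : ℤ, n ≤ -(N : ℤ) → F n = ⊥) (htop : ∀ n : ℤ, (N : ℤ) ≤ n → F n = ⊤)
    {e : H ⟶ H} (hmaps : ∀ n : ℤ, (F (n + 2)).Factors ((F n).arrow ≫ e))
    (hHL : ∀ i : ℕ, IsIso (eBarPowC F hmono e hmaps i (-(i : ℤ)))) (i : ℕ) :
    ∃! f : PrimC F hmono e hmaps i ⟶ (F (-(i : ℤ)) : A),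
      (f ≫ grπ hmono (-(i : ℤ)) =
        primι hmono hmaps i) ∧
      (∀ s : ℕ, i < s →
        (F ((s : ℤ) - 1)).Factors (f ≫ (F (-(i : ℤ))).arrow ≫ cpow e s)) := by
  have vanish : ∀ {T : A} (d : T ⟶ (F (-(i : ℤ)) : A)),
      d ≫ grπ hmono (-(i : ℤ)) = 0 →
      (∀ s : ℕ, i < s → (F ((s : ℤ) - 1)).Factors (d ≫ (F (-(i : ℤ))).arrow ≫ cpow e s)) →
      d = 0 := by
    intro T d hd hs
    rw [← cancel_mono (F (-(i : ℤ))).arrow, zero_comp]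
    exact eq_zero_of_factors hmono hbot hmaps hHL i ((comp_grπ_eq_zero_iff hmono d).1 hd)
      (by simpa using hs)
  obtain ⟨T, p, hp, x, hx, hs⟩ := lift_factors_refinement hmono hmaps hHL i N
  have hs' : ∀ s : ℕ, i < s →
      (F ((s : ℤ) - 1)).Factors (x ≫ (F (-(i : ℤ))).arrow ≫ cpow e s) := by
    intro s his
    rcases Nat.lt_or_ge (i + N) s with h | h
    · rw [htop _ (by omega)]
      exact Subobject.top_factors _
    · exact hs s his h
  have hker : kernel.ι p ≫ x = 0 := by
    refine vanish _ ?_ fun s his => ?_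
    · rw [Category.assoc, hx, ← Category.assoc, kernel.condition, zero_comp]
    · simpa using factors_precomp _ (kernel.ι p) (hs' s his)
  have hdesc : p ≫ Abelian.epiDesc p x hker = x := Abelian.comp_epiDesc p x hker
  refine ⟨Abelian.epiDesc p x hker, ⟨?_, fun s his => ?_⟩, ?_⟩
  · rw [← cancel_epi p, ← Category.assoc, hdesc, hx]
  · refine factors_of_epi_comp _ p ?_
    rw [← Category.assoc, hdesc]
    exact hs' s his
  · rintro g ⟨hg, hgs⟩
    rw [← cancel_epi p, hdesc, ← sub_eq_zero]
    refine vanish _ ?_ fun s his => ?_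
    · rw [Preadditive.sub_comp, Category.assoc, hg, hx, sub_self]
    · simpa using factors_sub _ (factors_precomp _ p (hgs s his)) (hs' s his)

theorem mono_phiC (hmono : ∀ n : ℤ, F (n - 1) ≤ F n) (N : ℕ)
    {e : H ⟶ H} (hmaps : ∀ n : ℤ, (F (n + 2)).Factors ((F n).arrow ≫ e))
    (hHL : ∀ i : ℕ, IsIso (eBarPowC F hmono e hmaps i (-(i : ℤ))))
    (fam : ∀ i : ℕ, (PrimC F hmono e hmaps i ⟶ (F (-(i : ℤ)) : A)))
    (hlift : ∀ i : ℕ,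
      fam i ≫ grπ hmono (-(i : ℤ)) =
        primι hmono hmaps i)
    (hfac : ∀ i s : ℕ, i < s →
      (F ((s : ℤ) - 1)).Factors (fam i ≫ (F (-(i : ℤ))).arrow ≫ cpow e s)) :
    Mono (phiC F hmono e hmaps N fam) := by
  classical
  refine Preadditive.mono_of_cancel_zero _ fun {T} x hx => ?_
  let P : IdxC N → A := fun q => PrimC F hmono e hmaps (q.1.1 : ℕ)
  let c : ∀ q : IdxC N, T ⟶ P q := fun q => x ≫ biproduct.π P q
  let b : ∀ q : IdxC N, P q ⟶ H := fun q => fam (q.1.1 : ℕ) ≫ (F (-((q.1.1 : ℕ) : ℤ))).arrow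
  have hb : ∀ q, (F (-((q.1.1 : ℕ) : ℤ))).Factors (b q) := fun q => Subobject.factors_comp_arrow _
  have hsum : ∑ q, c q ≫ b q ≫ cpow e (q.1.2 : ℕ) = 0 := by
    rw [← hx, phiC, biproduct.desc_eq, Preadditive.comp_sum]
    simp [c, b, P]
  suffices hc : ∀ q, c q = 0 by
    refine biproduct.hom_ext _ _ fun q => ?_
    rw [zero_comp]
    exact hc q
  by_contra! hne
  let key : IdxC N → ℤ ×ₗ ℤ := fun q =>
    toLex (2 * ((q.1.2 : ℕ) : ℤ) - ((q.1.1 : ℕ) : ℤ), ((q.1.2 : ℕ) : ℤ))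
  obtain ⟨q₀, hq₀, hmax⟩ := Finset.exists_max_image
    (Finset.univ.filter fun q : IdxC N => c q ≠ 0) key (by simpa [Finset.Nonempty] using hne)
  simp only [Finset.mem_filter, Finset.mem_univ, true_and] at hq₀ hmax
  apply hq₀
  obtain ⟨t, ht⟩ : ∃ t : ℕ, (q₀.1.2 : ℕ) + t = (q₀.1.1 : ℕ) :=
    ⟨_, Nat.add_sub_cancel' q₀.2⟩
  have hother : ∀ q, q ≠ q₀ → (F (((q₀.1.1 : ℕ) : ℤ) - 1)).Factors
      (c q ≫ b q ≫ cpow e ((q.1.2 : ℕ) + t)) := by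
    intro q hq
    by_cases hcq : c q = 0
    · rw [hcq, zero_comp]
      exact Subobject.factors_zero
    refine factors_precomp _ _ ?_
    rcases (Prod.Lex.le_iff.1 (hmax q hcq)) with h | ⟨h1, h2⟩
    · simp only [key, ofLex_toLex] at h
      exact factors_comp_cpow hmono hmaps _ (by push_cast; omega) (hb q)
    · simp only [key, ofLex_toLex] at h1 h2
      have hlt : (q.1.2 : ℕ) < (q₀.1.2 : ℕ) := by
        refine lt_of_le_of_ne (by omega) fun h => hq ?_
        exact Subtype.ext (Prod.ext (Fin.ext (by omega)) (Fin.ext h))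
      have h3 := hfac (q.1.1 : ℕ) ((q.1.2 : ℕ) + t) (by omega)
      simp only [b, Category.assoc]
      exact factors_of_index_le hmono (by push_cast; omega) h3
  have hsum' : ∑ q, c q ≫ b q ≫ cpow e ((q.1.2 : ℕ) + t) = 0 := by
    have := hsum =≫ cpow e t
    simpa [Preadditive.sum_comp, cpow_add] using this
  rw [← Finset.add_sum_erase _ _ (Finset.mem_univ q₀), ← eq_neg_iff_add_eq_zero, ht,
    ← zero_sub] at hsum'
  have hq₀' : (F (((q₀.1.1 : ℕ) : ℤ) - 1)).Factors
      ((c q₀ ≫ b q₀) ≫ cpow e (q₀.1.1 : ℕ)) := by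
    rw [Category.assoc, hsum']
    exact factors_sub _ Subobject.factors_zero
      (factors_sum _ _ _ fun q hq => hother q (Finset.ne_of_mem_erase hq))
  have h := factors_pred_of_isIso_eBarPowC hmono hmaps (by ring) (hHL _)
    (factors_precomp _ (c q₀) (hb q₀)) hq₀'
  have h' := (comp_grπ_eq_zero_iff hmono (c q₀ ≫ fam (q₀.1.1 : ℕ))).2 (by simpa [b] using h)
  rw [Category.assoc, hlift] at h'
  exact zero_of_comp_mono _ h'

/-- The restriction of `phiC` to the summands of filtration degree at most `k`. -/
noncomputable def phiLE (hmono : ∀ n : ℤ, F (n - 1) ≤ F n)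
    {e : H ⟶ H} (hmaps : ∀ n : ℤ, (F (n + 2)).Factors ((F n).arrow ≫ e)) (N : ℕ)
    (fam : ∀ i : ℕ, (PrimC F hmono e hmaps i ⟶ (F (-(i : ℤ)) : A))) (k : ℤ) :
    (⨁ fun q' : IdxCk N k => PrimC F hmono e hmaps ((q'.1.1.1 : ℕ))) ⟶ H :=
  (biproduct.desc fun q' : IdxCk N k =>
    biproduct.ι (fun q : IdxC N => PrimC F hmono e hmaps ((q.1.1 : ℕ))) q'.1) ≫
    phiC F hmono e hmaps N fam

theorem ι_phiLE (hmono : ∀ n : ℤ, F (n - 1) ≤ F n)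
    {e : H ⟶ H} (hmaps : ∀ n : ℤ, (F (n + 2)).Factors ((F n).arrow ≫ e)) (N : ℕ)
    (fam : ∀ i : ℕ, (PrimC F hmono e hmaps i ⟶ (F (-(i : ℤ)) : A))) (k : ℤ) (q : IdxCk N k) :
    biproduct.ι (fun q' : IdxCk N k => PrimC F hmono e hmaps ((q'.1.1.1 : ℕ))) q ≫
        phiLE hmono hmaps N fam k =
      fam (q.1.1.1 : ℕ) ≫ (F (-((q.1.1.1 : ℕ) : ℤ))).arrow ≫ cpow e (q.1.1.2 : ℕ) := by
  rw [phiLE, ← Category.assoc, biproduct.ι_desc, phiC, biproduct.ι_desc]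

theorem mono_phiLE (hmono : ∀ n : ℤ, F (n - 1) ≤ F n)
    {e : H ⟶ H} (hmaps : ∀ n : ℤ, (F (n + 2)).Factors ((F n).arrow ≫ e)) (N : ℕ)
    (fam : ∀ i : ℕ, (PrimC F hmono e hmaps i ⟶ (F (-(i : ℤ)) : A)))
    (h : Mono (phiC F hmono e hmaps N fam)) (k : ℤ) : Mono (phiLE hmono hmaps N fam k) := by
  have : Mono (biproduct.desc fun q' : IdxCk N k =>
      biproduct.ι (fun q : IdxC N => PrimC F hmono e hmaps ((q.1.1 : ℕ))) q'.1) :=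
    mono_biproduct_desc_ι _ _
  exact mono_comp _ _

theorem mk_phiLE_eq (hmono : ∀ n : ℤ, F (n - 1) ≤ F n)
    {N : ℕ} (hbot : ∀ n : ℤ, n ≤ -(N : ℤ) → F n = ⊥)
    {e : H ⟶ H} (hmaps : ∀ n : ℤ, (F (n + 2)).Factors ((F n).arrow ≫ e))
    (hHL : ∀ i : ℕ, IsIso (eBarPowC F hmono e hmaps i (-(i : ℤ))))
    (fam : ∀ i : ℕ, (PrimC F hmono e hmaps i ⟶ (F (-(i : ℤ)) : A)))
    (hlift : ∀ i : ℕ,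
      fam i ≫ grπ hmono (-(i : ℤ)) =
        primι hmono hmaps i)
    (hφ : ∀ k, Mono (phiLE hmono hmaps N fam k)) (k : ℤ) :
    Subobject.mk (phiLE hmono hmaps N fam k) = F k := by
  let S : ℤ → Subobject H := fun k => Subobject.mk (phiLE hmono hmaps N fam k)
  have hι : ∀ (k : ℤ) (i j : ℕ), i ≤ N → j ≤ i → 2 * (j : ℤ) - i ≤ k →
      (S k).Factors (fam i ≫ (F (-(i : ℤ))).arrow ≫ cpow e j) := by
    intro k i j hi hj hk
    have := ι_phiLE hmono hmaps N fam k ⟨⟨(⟨i, by omega⟩, ⟨j, by omega⟩), hj⟩, hk⟩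
    dsimp only at this
    rw [← this, Subobject.mk_factors_iff]
    exact ⟨_, rfl⟩
  have hSF : ∀ (k : ℤ) (R : Subobject H) (g : H ⟶ H),
      (∀ i j : ℕ, i ≤ N → j ≤ i → 2 * (j : ℤ) - i ≤ k →
        R.Factors (fam i ≫ (F (-(i : ℤ))).arrow ≫ cpow e j ≫ g)) →
      R.Factors ((S k).arrow ≫ g) := by
    intro k R g h
    rw [← Subobject.underlyingIso_hom_comp_eq_mk, Category.assoc]
    refine factors_precomp _ _ (factors_of_biproduct _ _ fun q => ?_)
    rw [← Category.assoc, ι_phiLE]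
    have := h (q.1.1.1 : ℕ) (q.1.1.2 : ℕ) (by omega) q.1.2 q.2
    simpa using this
  have hSmono : ∀ {k l : ℤ}, k ≤ l → S k ≤ S l := by
    intro k l hkl
    have := hSF k (S l) (𝟙 H) fun i j hi hj hk => by
      simpa using hι l i j hi hj (hk.trans hkl)
    rw [Category.comp_id] at this
    exact Subobject.le_of_comm _ ((S l).factorThru_arrow _ this)
  have hspan : ∀ n : ℕ, ∀ k : ℤ, k ≤ -(N : ℤ) + n → F k ≤ S k := by
    intro n
    induction n with
    | zero =>
      intro k hk
      rw [hbot k (by simpa using hk)]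
      exact bot_le
    | succ n ih =>
      intro k hk
      rcases lt_or_ge (-(N : ℤ)) k with hNk | hNk
      swap
      · rw [hbot k hNk]
        exact bot_le
      have hlow : ∀ l < k, ∀ {T : A} {x : T ⟶ H}, (F l).Factors x → (S l).Factors x :=
        fun l hl T x hx => Subobject.factors_of_le x (ih l (by push_cast at hk; omega)) hx
      suffices h : (S k).Factors (F k).arrow from
        Subobject.le_of_comm _ ((S k).factorThru_arrow _ h)
      rcases lt_or_ge 0 k with hpos | hneg
      · obtain ⟨m, rfl⟩ := Int.eq_ofNat_of_zero_le hpos.le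
        obtain ⟨T', p, hp, y, hy, hxy⟩ := exists_refinement_of_isIso_eBarPowC hmono hmaps
          (j := m) (m := (m : ℤ)) (by ring) (hHL m) (F (m : ℤ)).factors_self
        refine factors_of_epi_comp _ p ?_
        rw [← sub_add_cancel (p ≫ (F (m : ℤ)).arrow) (y ≫ cpow e m)]
        refine Subobject.factors_add _ _
          (Subobject.factors_of_le _ (hSmono (by omega)) (hlow _ (by omega) hxy)) ?_
        refine factors_comp_of_arrow ?_ (hlow _ (by omega) hy)
        refine hSF _ _ _ fun i j hi hj hij => ?_
        rw [← cpow_add]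
        exact hι _ _ _ hi (by omega) (by push_cast; omega)
      · obtain ⟨m, rfl⟩ := Int.exists_eq_neg_ofNat hneg
        have h1 : (F ((m + 2 : ℕ) : ℤ)).Factors ((F (-(m : ℤ))).arrow ≫ cpow e (m + 1)) :=
          factors_comp_cpow hmono hmaps _ (by push_cast; omega) (F (-(m : ℤ))).factors_self
        obtain ⟨T', p, hp, y, hy, hxy⟩ := exists_refinement_of_isIso_eBarPowC hmono hmaps
          (j := m + 2) (by ring) (hHL (m + 2)) h1
        have hye : (F (-(m : ℤ))).Factors (y ≫ cpow e 1) :=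
          factors_comp_cpow hmono hmaps 1 (by push_cast; omega) hy
        obtain ⟨u, hu⟩ := exists_primitive hmono hmaps m (hlift m)
          (x := p ≫ (F (-(m : ℤ))).arrow - y ≫ cpow e 1)
          (factors_sub _ (Subobject.factors_of_factors_right _ (Subobject.factors_self _)) hye)
          (by
            rw [Preadditive.sub_comp, Category.assoc, Category.assoc, ← cpow_add,
              show 1 + (m + 1) = m + 2 by ring]
            exact factors_of_index_le hmono (by push_cast; omega) hxy)
        refine factors_of_epi_comp _ p ?_
        have hS1 : (S (-(m : ℤ))).Factors (y ≫ cpow e 1) := by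
          refine factors_comp_of_arrow ?_ (hlow _ (by push_cast; omega) hy)
          refine hSF _ _ _ fun i j hi hj hij => ?_
          rw [← cpow_add]
          exact hι _ _ _ hi (by push_cast at hij; omega) (by push_cast at hij ⊢; omega)
        have hS2 : (S (-(m : ℤ))).Factors (u ≫ fam m ≫ (F (-(m : ℤ))).arrow) := by
          have := hι (-(m : ℤ)) m 0 (by omega) (by omega) (by push_cast; omega)
          rw [cpow, Category.comp_id] at this
          exact factors_precomp _ _ this
        have hS3 := Subobject.factors_of_le _ (hSmono (show -(m : ℤ) - 1 ≤ -(m : ℤ) by omega))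
          (hlow _ (by omega) hu)
        rw [← sub_add_cancel (p ≫ (F (-(m : ℤ))).arrow) (y ≫ cpow e 1),
          ← sub_add_cancel (p ≫ (F (-(m : ℤ))).arrow - y ≫ cpow e 1)
            (u ≫ fam m ≫ (F (-(m : ℤ))).arrow)]
        exact Subobject.factors_add _ _ (Subobject.factors_add _ _ hS3 hS2) hS1
  refine le_antisymm ?_ (hspan (k + N).toNat k (by omega))
  have := hSF k (F k) (𝟙 H) fun i j hi hj hk => by
    rw [Category.comp_id, ← Category.assoc]
    exact factors_comp_cpow hmono hmaps j (by omega) (Subobject.factors_comp_arrow _)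
  rw [Category.comp_id] at this
  exact Subobject.le_of_comm _ ((F k).factorThru_arrow _ this)

end Filtration

/-- de Cataldo's splitting lemma for HL-triples in an abelian category.
For every `i ≥ 0` there is a unique `f_i : P_{-i} ⟶ F_{-i}` lifting the canonical inclusion
`P_{-i} ↪ Gr_{-i}` through the canonical epimorphism `F_{-i} ↠ Gr_{-i}` and such that, for
`s > i`, `e^s ∘ (F_{-i} ↪ H) ∘ f_i` factors through `F_{s-1} ↪ H`.  Moreover, the induced map
`φ_e : ⊕_{0 ≤ j ≤ i} P_{-i} ⟶ H` is an isomorphism, and it is filtered: for every `k`, its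
restriction to the sub-biproduct over the pairs with `2j - i ≤ k` factors through `F_k ↪ H`
and induces an isomorphism onto `F_k`. -/
theorem hl_triple_splitting
    (F : ℤ → Subobject H) (hmono : ∀ n : ℤ, F (n - 1) ≤ F n)
    (N : ℕ) (hbot : ∀ n : ℤ, n ≤ -(N : ℤ) → F n = ⊥) (htop : ∀ n : ℤ, (N : ℤ) ≤ n → F n = ⊤)
    (e : H ⟶ H) (hmaps : ∀ n : ℤ, (F (n + 2)).Factors ((F n).arrow ≫ e))
    (hHL : ∀ i : ℕ, IsIso (eBarPowC F hmono e hmaps i (-(i : ℤ)))) :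
    (∀ i : ℕ, ∃! f : PrimC F hmono e hmaps i ⟶ (F (-(i : ℤ)) : A),
      (f ≫ cokernel.π (Subobject.ofLE (F (-(i : ℤ) - 1)) (F (-(i : ℤ))) (hmono _)) =
        kernel.ι (eBarPowC F hmono e hmaps (i + 1) (-(i : ℤ)))) ∧
      (∀ s : ℕ, i < s →
        (F ((s : ℤ) - 1)).Factors (f ≫ (F (-(i : ℤ))).arrow ≫ cpow e s))) ∧
    (∀ fam : ∀ i : ℕ, (PrimC F hmono e hmaps i ⟶ (F (-(i : ℤ)) : A)),
      (∀ i : ℕ,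
        (fam i ≫ cokernel.π (Subobject.ofLE (F (-(i : ℤ) - 1)) (F (-(i : ℤ))) (hmono _)) =
          kernel.ι (eBarPowC F hmono e hmaps (i + 1) (-(i : ℤ)))) ∧
        (∀ s : ℕ, i < s →
          (F ((s : ℤ) - 1)).Factors (fam i ≫ (F (-(i : ℤ))).arrow ≫ cpow e s))) →
      IsIso (phiC F hmono e hmaps N fam) ∧
      ∀ k : ℤ,
        ∃ ψ : (⨁ fun q' : IdxCk N k => PrimC F hmono e hmaps ((q'.1.1.1 : ℕ))) ⟶ (F k : A),
          IsIso ψ ∧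
          ψ ≫ (F k).arrow =
            (biproduct.desc fun q' : IdxCk N k =>
              biproduct.ι (fun q : IdxC N => PrimC F hmono e hmaps ((q.1.1 : ℕ))) q'.1) ≫
              phiC F hmono e hmaps N fam) := by
  refine ⟨fun i => existsUnique_primitive_lift_s0 hmono hbot htop hmaps hHL i, fun fam hfam => ?_⟩
  have hφ := mono_phiC hmono N hmaps hHL fam (fun i => (hfam i).1) (fun i => (hfam i).2)
  have hmonoLE := mono_phiLE hmono hmaps N fam hφ
  have hk : ∀ k : ℤ, ∃ ψ : (⨁ fun q' : IdxCk N k =>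
      PrimC F hmono e hmaps ((q'.1.1.1 : ℕ))) ⟶ (F k : A),
      IsIso ψ ∧ ψ ≫ (F k).arrow = phiLE hmono hmaps N fam k := by
    intro k
    have h := mk_phiLE_eq hmono hbot hmaps hHL fam (fun i => (hfam i).1) hmonoLE k
    exact ⟨(Subobject.underlyingIso (phiLE hmono hmaps N fam k)).inv ≫
      (Subobject.isoOfEq _ _ h).hom, inferInstance, by simp⟩
  refine ⟨?_, hk⟩
  obtain ⟨ψ, hψ, hψφ⟩ := hk N
  have : IsIso (F (N : ℤ)).arrow := by
    rw [Subobject.isIso_arrow_iff_eq_top]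
    exact htop N le_rfl
  have : Epi (phiLE hmono hmaps N fam N) := by
    rw [← hψφ]
    infer_instance
  have : Epi (phiC F hmono e hmaps N fam) :=
    epi_of_epi_fac (h := phiLE hmono hmaps N fam N) rfl
  exact isIso_of_mono_of_epi _
end

section
/- Let (H, F, e) be an HL-triple of K-vector spaces. For every integer i ≥ 0 there exists a unique K-linear map f_i : P_{-i} → F_{-i} such that: (1) for every p ∈ P_{-i}, the class of f_i(p) in Gr_{-i} = F_{-i}/F_{-i-1} equals p (i.e. f_i lifts the inclusion P_{-i} ⊆ Gr_{-i}); and (2) for every integer s > i and every p ∈ P_{-i}, one has e^s(f_i(p)) ∈ F_{s-1}. -/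
open Submodule

variable {K H : Type*} [Field K] [AddCommGroup H] [Module K H]

/-- The `n`-th graded piece `Gr_n := F_n / F_{n-1}` of a filtration `F`. -/
abbrev Gr (F : ℤ → Submodule K H) (n : ℤ) : Type _ :=
  F n ⧸ (Submodule.comap (F n).subtype (F (n - 1)))

/-- The map on graded pieces induced by a filtered linear map. -/
noncomputable def grMap (F : ℤ → Submodule K H) (g : H →ₗ[K] H) (n m : ℤ)
    (h : ∀ x ∈ F n, g x ∈ F m) (h' : ∀ x ∈ F (n - 1), g x ∈ F (m - 1)) :
    Gr F n →ₗ[K] Gr F m :=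
  Submodule.mapQ _ _ (g.restrict h) fun x hx => h' x.1 hx

theorem pow_maps {F : ℤ → Submodule K H} {e : H →ₗ[K] H}
    (hmaps : ∀ n : ℤ, ∀ x ∈ F n, e x ∈ F (n + 2)) (j : ℕ) (n : ℤ) :
    ∀ x ∈ F n, (e ^ j) x ∈ F (n + 2 * j) := by
  induction j generalizing n with
  | zero => intro x hx; simpa using hx
  | succ j ih =>
    intro x hx
    have h2 := hmaps _ _ (ih n x hx)
    have h3 : (e ^ (j + 1)) x = e ((e ^ j) x) := by
      rw [pow_succ']; rfl
    rw [h3]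
    convert h2 using 2
    push_cast; ring

/-- The induced map `ē : Gr_n → Gr_{n+2}`. -/
noncomputable def eBar (F : ℤ → Submodule K H) (e : H →ₗ[K] H)
    (hmaps : ∀ n : ℤ, ∀ x ∈ F n, e x ∈ F (n + 2)) (n : ℤ) :
    Gr F n →ₗ[K] Gr F (n + 2) :=
  grMap F e n (n + 2) (hmaps n) (fun x hx => by
    have := hmaps (n - 1) x hx
    rwa [show n - 1 + 2 = n + 2 - 1 by ring] at this)

/-- The `j`-fold iterate `ē^j : Gr_n → Gr_{n+2j}`, induced by `e^j`. -/
noncomputable def eBarPow (F : ℤ → Submodule K H) (e : H →ₗ[K] H)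
    (hmaps : ∀ n : ℤ, ∀ x ∈ F n, e x ∈ F (n + 2)) (j : ℕ) (n : ℤ) :
    Gr F n →ₗ[K] Gr F (n + 2 * j) :=
  grMap F (e ^ j) n (n + 2 * j) (pow_maps hmaps j n) (fun x hx => by
    have := pow_maps hmaps j (n - 1) x hx
    rwa [show n - 1 + 2 * (j : ℤ) = n + 2 * j - 1 by ring] at this)

/-- The primitive part `P_{-i} := ker (ē^{i+1} : Gr_{-i} → Gr_{i+2})`. -/
noncomputable def Prim (F : ℤ → Submodule K H) (e : H →ₗ[K] H)
    (hmaps : ∀ n : ℤ, ∀ x ∈ F n, e x ∈ F (n + 2)) (i : ℕ) :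
    Submodule K (Gr F (-(i : ℤ))) :=
  LinearMap.ker (eBarPow F e hmaps (i + 1) (-(i : ℤ)))

/-- Transport of graded pieces along an equality of indices. -/
def grCast (F : ℤ → Submodule K H) {n m : ℤ} (h : n = m) : Gr F n ≃ₗ[K] Gr F m := by
  subst h; exact LinearEquiv.refl K (Gr F n)

theorem gr_mk_eq_zero_iff {F : ℤ → Submodule K H} {n : ℤ} (x : F n) :
    (Submodule.Quotient.mk x : Gr F n) = 0 ↔ (x : H) ∈ F (n - 1) :=
  Submodule.Quotient.mk_eq_zero _

theorem gr_mk_eq_iff {F : ℤ → Submodule K H} {n : ℤ} (x y : F n) :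
    (Submodule.Quotient.mk x : Gr F n) = Submodule.Quotient.mk y ↔ (x : H) - y ∈ F (n - 1) :=
  Submodule.Quotient.eq _

theorem mem_of_pow_mem_of_injective {F : ℤ → Submodule K H} {e : H →ₗ[K] H}
    (hmaps : ∀ n : ℤ, ∀ x ∈ F n, e x ∈ F (n + 2)) {t : ℕ}
    (hinj : Function.Injective (eBarPow F e hmaps t (-(t : ℤ)))) {x : H}
    (hx : x ∈ F (-(t : ℤ))) (hex : (e ^ t) x ∈ F ((t : ℤ) - 1)) : x ∈ F (-(t : ℤ) - 1) := by
  have hzero : eBarPow F e hmaps t (-(t : ℤ)) (Submodule.Quotient.mk ⟨x, hx⟩) = 0 := by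
    refine (gr_mk_eq_zero_iff _).2 ?_
    change (e ^ t) x ∈ F (-(t : ℤ) + 2 * t - 1)
    rwa [show -(t : ℤ) + 2 * t = t by ring]
  exact (gr_mk_eq_zero_iff _).1 (hinj (hzero.trans (map_zero _).symm))

theorem exists_pow_sub_mem_of_surjective {F : ℤ → Submodule K H} {e : H →ₗ[K] H}
    (hmaps : ∀ n : ℤ, ∀ x ∈ F n, e x ∈ F (n + 2)) {t : ℕ}
    (hsurj : Function.Surjective (eBarPow F e hmaps t (-(t : ℤ)))) {z : H}
    (hz : z ∈ F (t : ℤ)) : ∃ y ∈ F (-(t : ℤ)), (e ^ t) y - z ∈ F ((t : ℤ) - 1) := by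
  have ht : -(t : ℤ) + 2 * t = t := by ring
  obtain ⟨y, hy⟩ := hsurj (Submodule.Quotient.mk ⟨z, by rwa [ht]⟩)
  obtain ⟨y, rfl⟩ := Submodule.Quotient.mk_surjective _ y
  have h : (e ^ t) (y : H) - z ∈ F (-(t : ℤ) + 2 * t - 1) := (gr_mk_eq_iff _ _).1 hy
  exact ⟨y, y.2, by rwa [ht] at h⟩

/-- The elements `x` of `F_{-i}` with `e^s x ∈ F_{s-1}` for all `s > i`. -/
def primitiveLifts (F : ℤ → Submodule K H) (e : H →ₗ[K] H) (i : ℕ) :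
    Submodule K (F (-(i : ℤ))) where
  carrier := {x | ∀ s : ℕ, i < s → (e ^ s) (x : H) ∈ F ((s : ℤ) - 1)}
  add_mem' hx hy s hs := by
    simpa using add_mem (hx s hs) (hy s hs)
  zero_mem' s _ := by simp
  smul_mem' c x hx s hs := by
    simpa using Submodule.smul_mem _ c (hx s hs)

theorem eq_zero_of_mem_primitiveLifts {F : ℤ → Submodule K H} {e : H →ₗ[K] H}
    (hfin : ∃ N : ℕ, ∀ n : ℤ, n ≤ -(N : ℤ) → F n = ⊥)
    (hmaps : ∀ n : ℤ, ∀ x ∈ F n, e x ∈ F (n + 2))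
    (hinj : ∀ i : ℕ, Function.Injective (eBarPow F e hmaps i (-(i : ℤ))))
    {i : ℕ} {x : F (-(i : ℤ))} (hx : x ∈ primitiveLifts F e i)
    (hx' : (x : H) ∈ F (-(i : ℤ) - 1)) : x = 0 := by
  obtain ⟨N, hN⟩ := hfin
  have hmem : ∀ k : ℕ, (x : H) ∈ F (-((i + k : ℕ) : ℤ) - 1) := by
    intro k
    induction k with
    | zero => simpa using hx'
    | succ k ih =>
      refine mem_of_pow_mem_of_injective hmaps (hinj _) ?_ (hx _ (by omega))
      convert ih using 2
      push_cast
      ring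
  have h := hmem N
  rw [hN _ (by omega)] at h
  exact Subtype.ext ((Submodule.mem_bot K).1 h)

theorem mk_mem_Prim_of_mem_primitiveLifts {F : ℤ → Submodule K H} {e : H →ₗ[K] H}
    (hmono : Monotone F)
    (hmaps : ∀ n : ℤ, ∀ x ∈ F n, e x ∈ F (n + 2)) {i : ℕ} {x : F (-(i : ℤ))}
    (hx : x ∈ primitiveLifts F e i) :
    (Submodule.Quotient.mk x : Gr F (-(i : ℤ))) ∈ Prim F e hmaps i := by
  refine LinearMap.mem_ker.2 ((gr_mk_eq_zero_iff _).2 ?_)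
  change (e ^ (i + 1)) (x : H) ∈ F (-(i : ℤ) + 2 * (i + 1 : ℕ) - 1)
  exact hmono (by push_cast; omega) (hx (i + 1) (by omega))

theorem exists_sub_mem_and_pow_mem {F : ℤ → Submodule K H} {e : H →ₗ[K] H}
    (hmono : Monotone F) (hmaps : ∀ n : ℤ, ∀ x ∈ F n, e x ∈ F (n + 2))
    (hsurj : ∀ i : ℕ, Function.Surjective (eBarPow F e hmaps i (-(i : ℤ))))
    {i : ℕ} {x : H} (hex : (e ^ (i + 1)) x ∈ F ((i : ℤ) + 1)) (k : ℕ) :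
    ∃ y : H, y - x ∈ F (-(i : ℤ) - 1) ∧ (e ^ (i + k + 1)) y ∈ F ((i : ℤ) + k + 1) ∧
      ∀ s : ℕ, i < s → s ≤ i + k → (e ^ s) y ∈ F ((s : ℤ) - 1) := by
  induction k with
  | zero => exact ⟨x, by simp, by simpa using hex, fun s _ _ => by omega⟩
  | succ k ih =>
    obtain ⟨y, hyx, hy, hys⟩ := ih
    obtain ⟨z, hz, hzy⟩ := exists_pow_sub_mem_of_surjective hmaps (hsurj (i + k + 1))
      (z := (e ^ (i + k + 1)) y) (by exact_mod_cast hy)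
    have hlast : (e ^ (i + k + 1)) (y - z) ∈ F (((i + k + 1 : ℕ) : ℤ) - 1) := by
      simpa using neg_mem hzy
    refine ⟨y - z, ?_, ?_, fun s his hs => ?_⟩
    · rw [sub_right_comm]
      exact sub_mem hyx (hmono (by push_cast; omega) hz)
    · have h := hmaps _ _ hlast
      rw [show i + (k + 1) + 1 = (i + k + 1) + 1 by ring, pow_succ']
      exact hmono (by push_cast; omega) h
    · obtain rfl | hs := (show s ≤ i + k + 1 from hs).eq_or_lt
      · exact hlast
      · rw [map_sub]
        exact sub_mem (hys s his (by omega))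
          (hmono (by push_cast; omega) (pow_maps hmaps s _ z hz))

theorem exists_primitiveLifts_mk_eq {F : ℤ → Submodule K H} {e : H →ₗ[K] H}
    (hmono : Monotone F) (hfin : ∃ N : ℕ, ∀ n : ℤ, (N : ℤ) ≤ n → F n = ⊤)
    (hmaps : ∀ n : ℤ, ∀ x ∈ F n, e x ∈ F (n + 2))
    (hsurj : ∀ i : ℕ, Function.Surjective (eBarPow F e hmaps i (-(i : ℤ))))
    {i : ℕ} (p : Prim F e hmaps i) :
    ∃ x ∈ primitiveLifts F e i, (Submodule.Quotient.mk x : Gr F (-(i : ℤ))) = p := by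
  obtain ⟨N, hN⟩ := hfin
  obtain ⟨p, hp⟩ := p
  obtain ⟨x, rfl⟩ := Submodule.Quotient.mk_surjective _ p
  have hex : (e ^ (i + 1)) (x : H) ∈ F (-(i : ℤ) + 2 * (i + 1 : ℕ) - 1) :=
    (gr_mk_eq_zero_iff _).1 (LinearMap.mem_ker.1 hp)
  obtain ⟨y, hyx, -, hy⟩ := exists_sub_mem_and_pow_mem hmono hmaps hsurj
    (hmono (by push_cast; omega) hex) N
  have hyF : y ∈ F (-(i : ℤ)) := by
    simpa using add_mem (hmono (by omega) hyx) x.2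
  refine ⟨⟨y, hyF⟩, fun s his => ?_, (gr_mk_eq_iff _ _).2 hyx⟩
  by_cases hs : s ≤ i + N
  · exact hy s his hs
  · rw [hN _ (by omega)]
    exact Submodule.mem_top

/-- existence and uniqueness of the canonical lift `f_i : P_{-i} → F_{-i}`
in an HL-triple of `K`-vector spaces. -/
theorem existsUnique_primitive_lift
    (F : ℤ → Submodule K H) (e : H →ₗ[K] H)
    (hmono : ∀ n : ℤ, F (n - 1) ≤ F n)
    (hfin : ∃ N : ℕ, (∀ n : ℤ, n ≤ -(N : ℤ) → F n = ⊥) ∧ (∀ n : ℤ, (N : ℤ) ≤ n → F n = ⊤))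
    (hmaps : ∀ n : ℤ, ∀ x ∈ F n, e x ∈ F (n + 2))
    (hHL : ∀ i : ℕ, Function.Bijective (eBarPow F e hmaps i (-(i : ℤ))))
    (i : ℕ) :
    ∃! f : Prim F e hmaps i →ₗ[K] F (-(i : ℤ)),
      (∀ p : Prim F e hmaps i,
        (Submodule.Quotient.mk (f p) : Gr F (-(i : ℤ))) = (p : Gr F (-(i : ℤ)))) ∧
      (∀ s : ℕ, i < s → ∀ p : Prim F e hmaps i, (e ^ s) (f p : H) ∈ F ((s : ℤ) - 1)) := by
  have hmono' : Monotone F := monotone_int_of_le_succ fun n => by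
    simpa using hmono (n + 1)
  have hbot := hfin.imp fun _ h => h.1
  have htop := hfin.imp fun _ h => h.2
  let q : primitiveLifts F e i →ₗ[K] Prim F e hmaps i :=
    ((Submodule.mkQ _).comp (primitiveLifts F e i).subtype).codRestrict _ fun x =>
      mk_mem_Prim_of_mem_primitiveLifts hmono' hmaps x.2
  have hq : Function.Bijective q := by
    refine ⟨(injective_iff_map_eq_zero q).2 fun x hx => Subtype.ext ?_, fun p => ?_⟩
    · exact eq_zero_of_mem_primitiveLifts hbot hmaps (fun j => (hHL j).1) x.2
        ((gr_mk_eq_zero_iff _).1 (congrArg Subtype.val hx))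
    · obtain ⟨x, hx, hxp⟩ :=
        exists_primitiveLifts_mk_eq hmono' htop hmaps (fun j => (hHL j).2) p
      exact ⟨⟨x, hx⟩, Subtype.ext hxp⟩
  let E := LinearEquiv.ofBijective q hq
  refine ⟨(primitiveLifts F e i).subtype.comp E.symm.toLinearMap,
    ⟨fun p => congrArg Subtype.val (E.apply_symm_apply p), fun s hs p => (E.symm p).2 s hs⟩, ?_⟩
  rintro g ⟨hg, hgs⟩
  ext1 p
  have hgp : q ⟨g p, fun s hs => hgs s hs p⟩ = p := Subtype.ext (hg p)
  exact congrArg Subtype.val (E.eq_symm_apply.2 hgp)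
end

section
/- Let (H, F, e) be an HL-triple of K-vector spaces, and for each i ≥ 0 let f_i : P_{-i} → F_{-i} be the unique K-linear map such that f_i lifts the inclusion P_{-i} ⊆ Gr_{-i} and e^s(f_i(p)) ∈ F_{s-1} for all s > i and p ∈ P_{-i}. Then the K-linear map φ_e : ⊕_{(i,j) : 0 ≤ j ≤ i} P_{-i} → H, defined on the (i,j)-indexed summand by p ↦ e^j(f_i(p)), is an isomorphism of filtered vector spaces: φ_e is bijective, and for every k ∈ ℤ it maps the subspace ⊕_{(i,j) : 0 ≤ j ≤ i, 2j−i ≤ k} P_{-i} bijectively onto F_k. -/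
open Submodule

variable {K H : Type*} [Field K] [AddCommGroup H] [Module K H]

open DirectSum

/-- The map `φ_e : ⊕_{(i,j) : 0 ≤ j ≤ i} P_{-i} → H`, given on the `(i,j)`-summand by
`p ↦ e^j (f_i p)`. -/
noncomputable def phiE (F : ℤ → Submodule K H) (e : H →ₗ[K] H)
    (hmaps : ∀ n : ℤ, ∀ x ∈ F n, e x ∈ F (n + 2))
    (f : ∀ i : ℕ, Prim F e hmaps i →ₗ[K] F (-(i : ℤ))) :
    (⨁ q : {q : ℕ × ℕ // q.2 ≤ q.1}, Prim F e hmaps q.1.1) →ₗ[K] H :=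
  DirectSum.toModule K _ H fun q =>
    ((e ^ q.1.2) ∘ₗ (F (-(q.1.1 : ℤ))).subtype) ∘ₗ f q.1.1

/-- The sub-biproduct `⊕_{(i,j) : 0 ≤ j ≤ i, 2j - i ≤ k} P_{-i}` inside the direct sum. -/
noncomputable def subSum (F : ℤ → Submodule K H) (e : H →ₗ[K] H)
    (hmaps : ∀ n : ℤ, ∀ x ∈ F n, e x ∈ F (n + 2)) (k : ℤ) :
    Submodule K (⨁ q : {q : ℕ × ℕ // q.2 ≤ q.1}, Prim F e hmaps q.1.1) :=
  ⨆ q : {q : {q : ℕ × ℕ // q.2 ≤ q.1} // 2 * (q.1.2 : ℤ) - (q.1.1 : ℤ) ≤ k},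
    LinearMap.range
      (DirectSum.lof K {q : ℕ × ℕ // q.2 ≤ q.1} (fun q => Prim F e hmaps q.1.1) q.1)

section HardLefschetz

variable {F : ℤ → Submodule K H} {e : H →ₗ[K] H}

theorem grMap_mk_eq_zero_iff {g : H →ₗ[K] H} {n m : ℤ}
    {h : ∀ x ∈ F n, g x ∈ F m} {h' : ∀ x ∈ F (n - 1), g x ∈ F (m - 1)} (x : F n) :
    grMap F g n m h h' (Submodule.Quotient.mk x) = 0 ↔ g x ∈ F (m - 1) := by
  change (Submodule.Quotient.mk (g.restrict h x) : Gr F m) = 0 ↔ _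
  rw [Submodule.Quotient.mk_eq_zero]
  rfl

theorem mem_pred_of_eBarPow_injective {hmaps : ∀ n : ℤ, ∀ x ∈ F n, e x ∈ F (n + 2)} {i : ℕ}
    (hinj : Function.Injective (eBarPow F e hmaps i (-(i : ℤ)))) {x : H}
    (hx : x ∈ F (-(i : ℤ))) (hex : (e ^ i) x ∈ F ((i : ℤ) - 1)) :
    x ∈ F (-(i : ℤ) - 1) := by
  have h0 : eBarPow F e hmaps i (-(i : ℤ)) (Submodule.Quotient.mk ⟨x, hx⟩) = 0 := by
    refine (grMap_mk_eq_zero_iff _).2 ?_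
    rwa [show -(i : ℤ) + 2 * i - 1 = i - 1 by ring]
  have h1 := (map_eq_zero_iff _ hinj).1 h0
  rwa [Submodule.Quotient.mk_eq_zero] at h1

theorem exists_sub_mem_pred_of_eBarPow_surjective
    {hmaps : ∀ n : ℤ, ∀ x ∈ F n, e x ∈ F (n + 2)} {i : ℕ}
    (hsurj : Function.Surjective (eBarPow F e hmaps i (-(i : ℤ)))) {y : H}
    (hy : y ∈ F (i : ℤ)) :
    ∃ x ∈ F (-(i : ℤ)), y - (e ^ i) x ∈ F ((i : ℤ) - 1) := by
  have hi : -(i : ℤ) + 2 * i = i := by ring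
  have hy' : y ∈ F (-(i : ℤ) + 2 * i) := by rwa [hi]
  obtain ⟨x, hx⟩ := hsurj (Submodule.Quotient.mk ⟨y, hy'⟩)
  obtain ⟨x, rfl⟩ := Submodule.Quotient.mk_surjective _ x
  refine ⟨x, x.2, ?_⟩
  have h1 := (Submodule.Quotient.eq _).1 hx.symm
  have h2 : y - (e ^ i) x ∈ F (-(i : ℤ) + 2 * i - 1) := h1
  rwa [hi] at h2

variable {hmaps : ∀ n : ℤ, ∀ x ∈ F n, e x ∈ F (n + 2)}
  {f : ∀ i : ℕ, Prim F e hmaps i →ₗ[K] F (-(i : ℤ))}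

theorem exists_sub_lift_mem_pred
    (hlift : ∀ (i : ℕ) (p : Prim F e hmaps i),
      (Submodule.Quotient.mk (f i p) : Gr F (-(i : ℤ))) = (p : Gr F (-(i : ℤ))))
    {i : ℕ} {x : H} (hx : x ∈ F (-(i : ℤ))) (hex : (e ^ (i + 1)) x ∈ F ((i : ℤ) + 1)) :
    ∃ p : Prim F e hmaps i, x - f i p ∈ F (-(i : ℤ) - 1) := by
  have hp : (Submodule.Quotient.mk ⟨x, hx⟩ : Gr F (-(i : ℤ))) ∈ Prim F e hmaps i := by
    refine LinearMap.mem_ker.2 ((grMap_mk_eq_zero_iff _).2 ?_)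
    rwa [show -(i : ℤ) + 2 * ((i + 1 : ℕ) : ℤ) - 1 = i + 1 by push_cast; ring]
  have h := (Submodule.Quotient.eq _).1 (hlift i ⟨_, hp⟩).symm
  exact ⟨⟨_, hp⟩, h⟩

theorem eq_zero_of_pow_lift_mem
    (hlift : ∀ (i : ℕ) (p : Prim F e hmaps i),
      (Submodule.Quotient.mk (f i p) : Gr F (-(i : ℤ))) = (p : Gr F (-(i : ℤ))))
    {i : ℕ} (hinj : Function.Injective (eBarPow F e hmaps i (-(i : ℤ))))
    {p : Prim F e hmaps i} (hp : (e ^ i) (f i p : H) ∈ F ((i : ℤ) - 1)) : p = 0 := by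
  have h := mem_pred_of_eBarPow_injective hinj (f i p).2 hp
  rw [← Submodule.coe_eq_zero, ← hlift i p, Submodule.Quotient.mk_eq_zero]
  exact h

@[simp]
theorem phiE_lof (q : {q : ℕ × ℕ // q.2 ≤ q.1}) (p : Prim F e hmaps q.1.1) :
    phiE F e hmaps f (DirectSum.lof K {q : ℕ × ℕ // q.2 ≤ q.1}
      (fun q => Prim F e hmaps q.1.1) q p) = (e ^ q.1.2) (f q.1.1 p : H) := by
  rw [phiE, DirectSum.toModule_lof]
  rfl

theorem map_phiE_subSum_le_iff {k : ℤ} {S : Submodule K H} :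
    Submodule.map (phiE F e hmaps f) (subSum F e hmaps k) ≤ S ↔
      ∀ i j : ℕ, j ≤ i → 2 * (j : ℤ) - i ≤ k → ∀ p : Prim F e hmaps i,
        (e ^ j) (f i p : H) ∈ S := by
  rw [subSum, Submodule.map_iSup, iSup_le_iff]
  constructor
  · intro h i j hji hk p
    exact h ⟨⟨(i, j), hji⟩, hk⟩ ⟨_, ⟨p, rfl⟩, phiE_lof ⟨(i, j), hji⟩ p⟩
  · rintro h ⟨⟨⟨i, j⟩, hji⟩, hk⟩ _ ⟨_, ⟨p, rfl⟩, rfl⟩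
    rw [phiE_lof]
    exact h i j hji hk p

theorem pow_lift_mem_map_phiE {k : ℤ} {i j : ℕ} (hji : j ≤ i) (hk : 2 * (j : ℤ) - i ≤ k)
    (p : Prim F e hmaps i) :
    (e ^ j) (f i p : H) ∈ Submodule.map (phiE F e hmaps f) (subSum F e hmaps k) :=
  map_phiE_subSum_le_iff.1 le_rfl i j hji hk p

theorem map_phiE_subSum_mono :
    Monotone fun k => Submodule.map (phiE F e hmaps f) (subSum F e hmaps k) := fun _ _ hkl =>
  map_phiE_subSum_le_iff.2 fun _ _ hji hk p => pow_lift_mem_map_phiE hji (hk.trans hkl) p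

theorem pow_mem_map_phiE {k l : ℤ} {m : ℕ} (hkm : k ≤ -m) (hl : k + 2 * m = l) {x : H}
    (hx : x ∈ Submodule.map (phiE F e hmaps f) (subSum F e hmaps k)) :
    (e ^ m) x ∈ Submodule.map (phiE F e hmaps f) (subSum F e hmaps l) := by
  suffices h : Submodule.map (phiE F e hmaps f) (subSum F e hmaps k) ≤
      Submodule.comap (e ^ m) (Submodule.map (phiE F e hmaps f) (subSum F e hmaps l)) from h hx
  refine map_phiE_subSum_le_iff.2 fun i j hji hk p => ?_
  rw [Submodule.mem_comap, ← Module.End.mul_apply, ← pow_add]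
  exact pow_lift_mem_map_phiE (by omega) (by push_cast; omega) p

theorem map_phiE_subSum_le (hF : Monotone F) (k : ℤ) :
    Submodule.map (phiE F e hmaps f) (subSum F e hmaps k) ≤ F k :=
  map_phiE_subSum_le_iff.2 fun i j _ hk p =>
    hF (by omega) (pow_maps hmaps j _ _ (f i p).2)

theorem le_map_phiE_subSum (hF : Monotone F) {N : ℕ} (hbot : ∀ n : ℤ, n ≤ -(N : ℤ) → F n = ⊥)
    (hHL : ∀ i : ℕ, Function.Surjective (eBarPow F e hmaps i (-(i : ℤ))))
    (hlift : ∀ (i : ℕ) (p : Prim F e hmaps i),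
      (Submodule.Quotient.mk (f i p) : Gr F (-(i : ℤ))) = (p : Gr F (-(i : ℤ)))) (k : ℤ) :
    F k ≤ Submodule.map (phiE F e hmaps f) (subSum F e hmaps k) := by
  set T := fun k => Submodule.map (phiE F e hmaps f) (subSum F e hmaps k)
  have hTmono : Monotone T := map_phiE_subSum_mono
  suffices h : ∀ (d : ℕ) (k : ℤ), k ≤ d - N → F k ≤ T k from
    h (k + N).toNat k (by omega)
  intro d
  induction d with
  | zero => intro k hk; rw [hbot k (by simpa using hk)]; exact bot_le
  | succ d ih =>
    intro k hk x hx
    have hpred : F (k - 1) ≤ T k :=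
      (ih (k - 1) (by push_cast at hk; omega)).trans (hTmono (by omega))
    rcases le_or_gt k 0 with hk0 | hk0
    · obtain ⟨i, rfl⟩ : ∃ i : ℕ, k = -(i : ℤ) := ⟨(-k).toNat, by omega⟩
      have hex : (e ^ (i + 1)) x ∈ F (((i + 2 : ℕ) : ℤ)) :=
        hF (by push_cast; omega) (pow_maps hmaps (i + 1) _ _ hx)
      obtain ⟨y, hy, hxy⟩ := exists_sub_mem_pred_of_eBarPow_surjective (hHL (i + 2)) hex
      have hyT : y ∈ T (-((i + 2 : ℕ) : ℤ)) := ih _ (by push_cast at hk ⊢; omega) hy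
      have heyT : (e ^ 1) y ∈ T (-(i : ℤ)) :=
        pow_mem_map_phiE (by push_cast; omega) (by push_cast; ring) hyT
      have hey : (e ^ 1) y ∈ F (-(i : ℤ)) :=
        hF (by push_cast; omega) (pow_maps hmaps 1 _ _ hy)
      have hprim : (e ^ (i + 1)) (x - (e ^ 1) y) ∈ F ((i : ℤ) + 1) := by
        rw [map_sub, ← Module.End.mul_apply, ← pow_add]
        exact hF (by push_cast; omega) hxy
      obtain ⟨p, hp⟩ := exists_sub_lift_mem_pred hlift (sub_mem hx hey) hprim
      have hfp : (f i p : H) ∈ T (-(i : ℤ)) :=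
        pow_lift_mem_map_phiE (j := 0) (Nat.zero_le _) (by simp) p
      have := add_mem (add_mem (hpred hp) hfp) heyT
      simpa using this
    · obtain ⟨i, rfl⟩ : ∃ i : ℕ, k = (i : ℤ) := ⟨k.toNat, by omega⟩
      obtain ⟨y, hy, hxy⟩ := exists_sub_mem_pred_of_eBarPow_surjective (hHL i) hx
      have hyT : y ∈ T (-(i : ℤ)) := ih _ (by push_cast at hk; omega) hy
      have heyT : (e ^ i) y ∈ T (i : ℤ) := pow_mem_map_phiE le_rfl (by ring) hyT
      simpa using add_mem (hpred hxy) heyT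

theorem phiE_injective (hF : Monotone F)
    (hHL : ∀ i : ℕ, Function.Injective (eBarPow F e hmaps i (-(i : ℤ))))
    (hlift : ∀ (i : ℕ) (p : Prim F e hmaps i),
      (Submodule.Quotient.mk (f i p) : Gr F (-(i : ℤ))) = (p : Gr F (-(i : ℤ))))
    (hvan : ∀ (i s : ℕ), i < s → ∀ p : Prim F e hmaps i,
      (e ^ s) (f i p : H) ∈ F (2 * (s : ℤ) - i - 1)) :
    Function.Injective (phiE F e hmaps f) := by
  classical
  let : AddCommGroup (⨁ q : {q : ℕ × ℕ // q.2 ≤ q.1}, Prim F e hmaps q.1.1) :=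
    Module.addCommMonoidToAddCommGroup K
  rw [injective_iff_map_eq_zero]
  intro x hx
  by_contra hx0
  have hne : (DFinsupp.support x).Nonempty :=
    Finset.nonempty_iff_ne_empty.2 fun h => hx0 (DFinsupp.support_eq_empty.1 h)
  -- The leading term: maximal weight `2j - i`, then maximal `i`.
  obtain ⟨q, hq, hmax⟩ := Finset.exists_max_image (DFinsupp.support x)
    (fun q => toLex (2 * (q.1.2 : ℤ) - q.1.1, q.1.1)) hne
  have hsum : ∑ r ∈ DFinsupp.support x, (e ^ r.1.2) (f r.1.1 (x r) : H) = 0 := by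
    rw [← hx]
    conv_rhs => rw [← DirectSum.sum_support_of x, map_sum]
    exact Finset.sum_congr rfl fun r _ => (phiE_lof r (x r)).symm
  rw [← Finset.add_sum_erase _ _ hq] at hsum
  obtain ⟨s, hs⟩ := Nat.exists_eq_add_of_le q.2
  have hrest : (e ^ s) (∑ r ∈ (DFinsupp.support x).erase q, (e ^ r.1.2) (f r.1.1 (x r) : H)) ∈
      F ((q.1.1 : ℤ) - 1) := by
    rw [map_sum]
    refine sum_mem fun r hr => ?_
    obtain ⟨hrq, hr⟩ := Finset.mem_erase.1 hr
    rw [← Module.End.mul_apply, ← pow_add]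
    have hrq' : ¬ (r.1.1 = q.1.1 ∧ r.1.2 = q.1.2) := fun h =>
      hrq (Subtype.ext (Prod.ext h.1 h.2))
    rcases (Prod.Lex.toLex_le_toLex).1 (hmax r hr) with h | ⟨h, h'⟩
    · exact hF (by push_cast; dsimp at h; omega) (pow_maps hmaps (s + r.1.2) _ _ (f r.1.1 (x r)).2)
    · dsimp at h h'
      exact hF (by push_cast; omega) (hvan r.1.1 (s + r.1.2) (by omega) (x r))
  have hlead : (e ^ q.1.1) (f q.1.1 (x q) : H) ∈ F ((q.1.1 : ℤ) - 1) := by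
    have h := congrArg (e ^ s) (eq_neg_of_add_eq_zero_left hsum)
    rw [← Module.End.mul_apply, ← pow_add, add_comm s, ← hs, map_neg] at h
    rw [h]
    exact neg_mem hrest
  exact (DFinsupp.mem_support_iff.1 hq) (eq_zero_of_pow_lift_mem hlift (hHL _) hlead)

end HardLefschetz

/-- `φ_e` is an isomorphism of filtered vector spaces: it is bijective and, for
every `k`, it maps the sub-biproduct over the pairs with `2j - i ≤ k` bijectively onto `F_k`. -/
theorem phiE_bijective_and_filtered
    (F : ℤ → Submodule K H) (e : H →ₗ[K] H)
    (hmono : ∀ n : ℤ, F (n - 1) ≤ F n)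
    (hfin : ∃ N : ℕ, (∀ n : ℤ, n ≤ -(N : ℤ) → F n = ⊥) ∧ (∀ n : ℤ, (N : ℤ) ≤ n → F n = ⊤))
    (hmaps : ∀ n : ℤ, ∀ x ∈ F n, e x ∈ F (n + 2))
    (hHL : ∀ i : ℕ, Function.Bijective (eBarPow F e hmaps i (-(i : ℤ))))
    (f : ∀ i : ℕ, Prim F e hmaps i →ₗ[K] F (-(i : ℤ)))
    (hlift : ∀ (i : ℕ) (p : Prim F e hmaps i),
      (Submodule.Quotient.mk (f i p) : Gr F (-(i : ℤ))) = (p : Gr F (-(i : ℤ))))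
    (hvan : ∀ (i s : ℕ), i < s → ∀ p : Prim F e hmaps i,
      (e ^ s) (f i p : H) ∈ F ((s : ℤ) - 1)) :
    Function.Bijective (phiE F e hmaps f) ∧
    ∀ k : ℤ, Submodule.map (phiE F e hmaps f) (subSum F e hmaps k) = F k := by
  have hF : Monotone F := monotone_int_of_le_succ fun n => by simpa using hmono (n + 1)
  obtain ⟨N, hbot, htop⟩ := hfin
  have hmap (k : ℤ) : Submodule.map (phiE F e hmaps f) (subSum F e hmaps k) = F k :=
    (map_phiE_subSum_le hF k).antisymm
      (le_map_phiE_subSum hF hbot (fun i => (hHL i).surjective) hlift k)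
  refine ⟨⟨phiE_injective hF (fun i => (hHL i).injective) hlift fun i s his p =>
    hF (by omega) (hvan i s his p), ?_⟩, hmap⟩
  rw [← LinearMap.range_eq_top, eq_top_iff, ← htop N le_rfl, ← hmap N]
  exact LinearMap.map_le_range
end

section
/- Let (H, F, e) be an HL-triple of K-vector spaces. For every b ∈ ℤ, the graded piece Gr_b is the internal direct sum of the subspaces ē^j(P_{-i}) over the (finitely many) pairs (i,j) with 0 ≤ j ≤ i and 2j − i = b; that is, these subspaces are in direct sum and together span Gr_b (the primitive Lefschetz decomposition of the associated graded). -/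
open Submodule

variable {K H : Type*} [Field K] [AddCommGroup H] [Module K H]

section GradedPow

variable (F : ℤ → Submodule K H) (e : H →ₗ[K] H) (hmaps : ∀ n : ℤ, ∀ x ∈ F n, e x ∈ F (n + 2))

/-- The iterate `ē^j : Gr_n → Gr_m`, with the target index free up to the equality
`n + 2 * j = m`. -/
noncomputable def gradedPow (j : ℕ) {n m : ℤ} (h : n + 2 * j = m) : Gr F n →ₗ[K] Gr F m :=
  grMap F (e ^ j) n m (fun x hx => h ▸ pow_maps hmaps j n x hx) (fun x hx => by
    have := pow_maps hmaps j (n - 1) x hx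
    rwa [show n - 1 + 2 * (j : ℤ) = m - 1 by omega] at this)

theorem eBarPow_eq_gradedPow (j : ℕ) (n : ℤ) :
    eBarPow F e hmaps j n = gradedPow F e hmaps j rfl := rfl

theorem grCast_comp_eBarPow (j : ℕ) {n m : ℤ} (h : n + 2 * j = m) :
    (grCast F h).toLinearMap ∘ₗ eBarPow F e hmaps j n = gradedPow F e hmaps j h := by
  subst h
  rfl

theorem gradedPow_gradedPow (j k l : ℕ) {n m p : ℤ} (h : n + 2 * j = m) (h' : m + 2 * k = p)
    (hl : k + j = l) (x : Gr F n) :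
    gradedPow F e hmaps k h' (gradedPow F e hmaps j h x) =
      gradedPow F e hmaps l (by omega) x := by
  subst hl
  obtain ⟨x, rfl⟩ := Submodule.Quotient.mk_surjective _ x
  exact congrArg (Submodule.Quotient.mk (p := (F (p - 1)).comap (F p).subtype))
    (Subtype.ext (LinearMap.congr_fun (pow_add e k j).symm x.1))

theorem gradedPow_zero {n : ℤ} (h : n + 2 * (0 : ℕ) = n) (x : Gr F n) :
    gradedPow F e hmaps 0 h x = x := by
  obtain ⟨x, rfl⟩ := Submodule.Quotient.mk_surjective _ x
  rfl

variable {F e hmaps}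

theorem gradedPow_bijective
    (hHL : ∀ i : ℕ, Function.Bijective (eBarPow F e hmaps i (-(i : ℤ)))) (i : ℕ) {n m : ℤ}
    (hn : n = -(i : ℤ)) (h : n + 2 * i = m) :
    Function.Bijective (gradedPow F e hmaps i h) := by
  subst hn h
  exact hHL i

theorem mem_Prim_iff (i : ℕ) {m : ℤ} (h : -(i : ℤ) + 2 * (i + 1 : ℕ) = m)
    (x : Gr F (-(i : ℤ))) :
    x ∈ Prim F e hmaps i ↔ gradedPow F e hmaps (i + 1) h x = 0 := by
  subst h
  rfl

theorem gradedPow_eq_zero_of_mem_Prim {i k : ℕ} (hik : i < k) {m : ℤ}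
    (h : -(i : ℤ) + 2 * k = m) {x : Gr F (-(i : ℤ))} (hx : x ∈ Prim F e hmaps i) :
    gradedPow F e hmaps k h x = 0 := by
  rw [← gradedPow_gradedPow F e hmaps (i + 1) (k - (i + 1)) k rfl (by omega) (by omega),
    (mem_Prim_iff i rfl x).1 hx, map_zero]

theorem neg_fst_add_two_mul_snd {b : ℤ}
    (q : {q : ℕ × ℕ // q.2 ≤ q.1 ∧ 2 * (q.2 : ℤ) - (q.1 : ℤ) = b}) :
    -(q.1.1 : ℤ) + 2 * (q.1.2 : ℤ) = b := by
  linarith [q.2.2]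

variable (F e hmaps) in
/-- The summand `ē^j(P_{-i})` of `Gr_b`, where `2 * j - i = b`. -/
noncomputable def primSummand (b : ℤ)
    (q : {q : ℕ × ℕ // q.2 ≤ q.1 ∧ 2 * (q.2 : ℤ) - (q.1 : ℤ) = b}) : Submodule K (Gr F b) :=
  (Prim F e hmaps q.1.1).map (gradedPow F e hmaps q.1.2 (neg_fst_add_two_mul_snd q))

theorem map_iSup_primSummand_le (j : ℕ) {n m : ℤ} (h : n + 2 * j = m) (hj : n + j ≤ 0) :
    (⨆ q, primSummand F e hmaps n q).map (gradedPow F e hmaps j h) ≤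
      ⨆ q, primSummand F e hmaps m q := by
  rw [Submodule.map_iSup, iSup_le_iff]
  rintro ⟨⟨k, l⟩, hl, hq⟩
  dsimp only at hl hq
  refine le_trans ?_ (le_iSup _ ⟨(k, j + l), by dsimp only; omega, by dsimp only; omega⟩)
  rintro _ ⟨_, ⟨y, hy, rfl⟩, rfl⟩
  exact ⟨y, hy, (gradedPow_gradedPow F e hmaps l j (j + l) _ _ rfl y).symm⟩

theorem iSup_primSummand_neg_eq_top (hbot : ∃ N : ℕ, ∀ n : ℤ, n ≤ -(N : ℤ) → F n = ⊥)
    (hHL : ∀ i : ℕ, Function.Bijective (eBarPow F e hmaps i (-(i : ℤ)))) (i : ℕ) :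
    ⨆ q, primSummand F e hmaps (-(i : ℤ)) q = ⊤ := by
  obtain ⟨N, hN⟩ := hbot
  induction hd : N - i using Nat.strong_induction_on generalizing i with
  | _ d ih =>
  rw [eq_top_iff]
  intro x _
  by_cases hi : N ≤ i
  · obtain ⟨x, rfl⟩ := Submodule.Quotient.mk_surjective _ x
    have hx : x = 0 := Subtype.ext ((Submodule.mem_bot K).1 (hN (-i) (by omega) ▸ x.2))
    simp [hx]
  have h2 : -((i + 2 : ℕ) : ℤ) + 2 * (1 : ℕ) = -(i : ℤ) := by push_cast; ring
  have hi1 : -(i : ℤ) + 2 * (i + 1 : ℕ) = (i + 2 : ℕ) := by push_cast; ring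
  obtain ⟨y, hy⟩ := (gradedPow_bijective hHL (i + 2) rfl
    (by omega : -((i + 2 : ℕ) : ℤ) + 2 * (i + 2 : ℕ) = (i + 2 : ℕ))).2
    (gradedPow F e hmaps (i + 1) hi1 x)
  rw [← sub_add_cancel x (gradedPow F e hmaps 1 h2 y)]
  refine Submodule.add_mem _ ?_ ?_
  · refine Submodule.mem_iSup_of_mem ⟨(i, 0), by simp, by simp⟩ ?_
    refine ⟨_, ?_, gradedPow_zero F e hmaps _ _⟩
    rw [SetLike.mem_coe, mem_Prim_iff i hi1, map_sub,
      gradedPow_gradedPow F e hmaps 1 (i + 1) (i + 2) h2 hi1 rfl, hy, sub_self]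
  · refine map_iSup_primSummand_le 1 h2 (by push_cast; omega) ⟨y, ?_, rfl⟩
    rw [ih _ (by omega) (i + 2) rfl]
    trivial

theorem iSup_primSummand_eq_top (hbot : ∃ N : ℕ, ∀ n : ℤ, n ≤ -(N : ℤ) → F n = ⊥)
    (hHL : ∀ i : ℕ, Function.Bijective (eBarPow F e hmaps i (-(i : ℤ)))) (b : ℤ) :
    ⨆ q, primSummand F e hmaps b q = ⊤ := by
  obtain ⟨i, rfl | rfl⟩ := b.eq_nat_or_neg
  · have h : -(i : ℤ) + 2 * i = i := by ring
    rw [eq_top_iff, ← LinearMap.range_eq_top.2 (gradedPow_bijective hHL i rfl h).2,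
      LinearMap.range_eq_map, ← iSup_primSummand_neg_eq_top hbot hHL i]
    exact map_iSup_primSummand_le i h (by omega)
  · exact iSup_primSummand_neg_eq_top hbot hHL i

theorem iSupIndep_primSummand
    (hHL : ∀ i : ℕ, Function.Bijective (eBarPow F e hmaps i (-(i : ℤ)))) (b : ℤ) :
    iSupIndep (primSummand F e hmaps b) := by
  classical
  rw [iSupIndep_iff_finsetSum_eq_zero_imp_eq_zero]
  intro s v hv hsum
  by_contra! hne
  obtain ⟨q₀, hq₀, hne₀⟩ := hne
  obtain ⟨q, hq, hmax⟩ := (s.filter (v · ≠ 0)).exists_max_image (fun q => q.1.1)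
    ⟨q₀, Finset.mem_filter.2 ⟨hq₀, hne₀⟩⟩
  rw [Finset.mem_filter] at hq
  obtain ⟨hqs, hvq⟩ := hq
  have hq1 := q.2.1
  have hq2 := q.2.2
  have hm : b + 2 * ((q.1.1 - q.1.2 : ℕ) : ℤ) = q.1.1 := by omega
  have key := congrArg (gradedPow F e hmaps (q.1.1 - q.1.2) hm) hsum
  rw [map_sum, map_zero, Finset.sum_eq_single_of_mem q hqs] at key
  · obtain ⟨y, -, hyq⟩ := hv q hqs
    rw [← hyq, gradedPow_gradedPow F e hmaps _ _ q.1.1 _ _ (by omega)] at key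
    have hy0 : y = 0 := (gradedPow_bijective hHL q.1.1 rfl (by ring)).1
      (key.trans (map_zero _).symm)
    exact hvq (by rw [← hyq, hy0, map_zero])
  · intro q' hq's hqq'
    by_cases h0 : v q' = 0
    · rw [h0, map_zero]
    have hle := hmax q' (Finset.mem_filter.2 ⟨hq's, h0⟩)
    have h1 := q'.2.1
    have h2 := q'.2.2
    have hlt : q'.1.1 ≠ q.1.1 := fun h =>
      hqq' (Subtype.ext (Prod.ext h (by omega)))
    obtain ⟨y, hy, hyq⟩ := hv q' hq's
    rw [← hyq, gradedPow_gradedPow F e hmaps _ _ _ _ _ rfl]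
    exact gradedPow_eq_zero_of_mem_Prim (by omega) _ hy

end GradedPow

/-- the primitive Lefschetz decomposition of the associated graded: for every
`b : ℤ`, the graded piece `Gr_b` is the internal direct sum of the subspaces `ē^j(P_{-i})`
over the pairs `(i, j)` with `0 ≤ j ≤ i` and `2j - i = b`. -/
theorem primitive_lefschetz_decomposition
    (F : ℤ → Submodule K H) (e : H →ₗ[K] H)
    (hmono : ∀ n : ℤ, F (n - 1) ≤ F n)
    (hfin : ∃ N : ℕ, (∀ n : ℤ, n ≤ -(N : ℤ) → F n = ⊥) ∧ (∀ n : ℤ, (N : ℤ) ≤ n → F n = ⊤))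
    (hmaps : ∀ n : ℤ, ∀ x ∈ F n, e x ∈ F (n + 2))
    (hHL : ∀ i : ℕ, Function.Bijective (eBarPow F e hmaps i (-(i : ℤ))))
    (b : ℤ) :
    iSupIndep (fun q : {q : ℕ × ℕ // q.2 ≤ q.1 ∧ 2 * (q.2 : ℤ) - (q.1 : ℤ) = b} =>
      Submodule.map
        ((grCast F (show -(q.1.1 : ℤ) + 2 * (q.1.2 : ℤ) = b by
            have := q.2.2; omega)).toLinearMap ∘ₗ
          eBarPow F e hmaps q.1.2 (-(q.1.1 : ℤ)))
        (Prim F e hmaps q.1.1)) ∧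
    (⨆ q : {q : ℕ × ℕ // q.2 ≤ q.1 ∧ 2 * (q.2 : ℤ) - (q.1 : ℤ) = b},
      Submodule.map
        ((grCast F (show -(q.1.1 : ℤ) + 2 * (q.1.2 : ℤ) = b by
            have := q.2.2; omega)).toLinearMap ∘ₗ
          eBarPow F e hmaps q.1.2 (-(q.1.1 : ℤ)))
        (Prim F e hmaps q.1.1)) = ⊤ := by
  simp only [grCast_comp_eBarPow]
  obtain ⟨N, hN, -⟩ := hfin
  exact ⟨iSupIndep_primSummand hHL b, iSup_primSummand_eq_top ⟨N, hN⟩ hHL b⟩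
end

section
/- Let (H, F, e) be an HL-triple of K-vector spaces. For every integer b ≤ −1, the induced map ē : Gr_b → Gr_{b+2} is injective, and for every integer b ≥ −1, the induced map ē : Gr_b → Gr_{b+2} is surjective. -/
open Submodule

variable {K H : Type*} [Field K] [AddCommGroup H] [Module K H]

theorem grMap_mkQ (F : ℤ → Submodule K H) (g : H →ₗ[K] H) (n m : ℤ)
    (h : ∀ x ∈ F n, g x ∈ F m) (h' : ∀ x ∈ F (n - 1), g x ∈ F (m - 1)) (x : F n) :
    grMap F g n m h h' (Submodule.mkQ _ x) = Submodule.mkQ _ ⟨g x, h x x.2⟩ :=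
  rfl

theorem grMap_injective_iff (F : ℤ → Submodule K H) (g : H →ₗ[K] H) (n m : ℤ)
    (h : ∀ x ∈ F n, g x ∈ F m) (h' : ∀ x ∈ F (n - 1), g x ∈ F (m - 1)) :
    Function.Injective (grMap F g n m h h') ↔
      ∀ x ∈ F n, g x ∈ F (m - 1) → x ∈ F (n - 1) := by
  rw [injective_iff_map_eq_zero, (Submodule.mkQ_surjective _).forall, Subtype.forall]
  refine forall₂_congr fun x hx => ?_
  rw [grMap_mkQ]
  simp only [Submodule.mkQ_apply, Submodule.Quotient.mk_eq_zero, Submodule.mem_comap,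
    Submodule.subtype_apply]

theorem grMap_surjective_iff (F : ℤ → Submodule K H) (g : H →ₗ[K] H) (n m : ℤ)
    (h : ∀ x ∈ F n, g x ∈ F m) (h' : ∀ x ∈ F (n - 1), g x ∈ F (m - 1)) :
    Function.Surjective (grMap F g n m h h') ↔
      ∀ y ∈ F m, ∃ x ∈ F n, g x - y ∈ F (m - 1) := by
  rw [Function.Surjective, (Submodule.mkQ_surjective _).forall, Subtype.forall]
  refine forall₂_congr fun y hy => ?_
  rw [(Submodule.mkQ_surjective _).exists, Subtype.exists]
  simp_rw [← exists_prop]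
  refine exists₂_congr fun x hx => ?_
  rw [grMap_mkQ]
  exact Submodule.Quotient.eq _

/-- in an HL-triple, `ē : Gr_b → Gr_{b+2}` is injective for `b ≤ -1`
and surjective for `b ≥ -1`. -/
theorem eBar_injective_of_le_neg_one_and_surjective_of_neg_one_le
    (F : ℤ → Submodule K H) (e : H →ₗ[K] H)
    (hmono : ∀ n : ℤ, F (n - 1) ≤ F n)
    (hfin : ∃ N : ℕ, (∀ n : ℤ, n ≤ -(N : ℤ) → F n = ⊥) ∧ (∀ n : ℤ, (N : ℤ) ≤ n → F n = ⊤))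
    (hmaps : ∀ n : ℤ, ∀ x ∈ F n, e x ∈ F (n + 2))
    (hHL : ∀ i : ℕ, Function.Bijective (eBarPow F e hmaps i (-(i : ℤ))))
    (b : ℤ) :
    (b ≤ -1 → Function.Injective (eBar F e hmaps b)) ∧
    (-1 ≤ b → Function.Surjective (eBar F e hmaps b)) := by
  refine ⟨fun hb => ?_, fun hb => ?_⟩
  · obtain ⟨j, rfl⟩ : ∃ j : ℕ, b = -((j + 1 : ℕ) : ℤ) := ⟨(-b - 1).toNat, by omega⟩
    have hinj := (grMap_injective_iff F _ _ _ _ _).1 (hHL (j + 1)).1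
    refine (grMap_injective_iff F _ _ _ _ _).2 fun x hx hex => hinj x hx ?_
    have := pow_maps hmaps j _ _ hex
    rw [pow_succ, Module.End.mul_apply]
    convert this using 2
    push_cast
    ring
  · obtain ⟨j, rfl⟩ : ∃ j : ℕ, b = (j : ℤ) - 1 := ⟨(b + 1).toNat, by omega⟩
    have hsurj := (grMap_surjective_iff F _ _ _ _ _).1 (hHL (j + 1)).2
    have hidx : -((j + 1 : ℕ) : ℤ) + 2 * ((j + 1 : ℕ) : ℤ) = (j : ℤ) - 1 + 2 := by
      push_cast
      ring
    rw [hidx] at hsurj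
    refine (grMap_surjective_iff F _ _ _ _ _).2 fun y hy => ?_
    obtain ⟨x, hx, hxy⟩ := hsurj y hy
    refine ⟨(e ^ j) x, ?_, by rwa [pow_succ', Module.End.mul_apply] at hxy⟩
    convert pow_maps hmaps j _ x hx using 2
    push_cast
    ring
end

section
/- Let (H, F, e) be an HL-triple of K-vector spaces, let i ≥ 0 be an integer, and let v ∈ F_{-i−1}. If e^s(v) ∈ F_{s−1} for every integer s > i, then v = 0. (This is the key step proving the uniqueness of the lifts f_i in the canonical splitting of an HL-triple.) -/
open Submodule

variable {K H : Type*} [Field K] [AddCommGroup H] [Module K H]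

/-- If `ē^k : Gr_{-k} → Gr_k` is injective, then `v ∈ F_{-k}` and `e^k v ∈ F_{k-1}` force
`v ∈ F_{-k-1}`. -/
theorem mem_sub_one_of_pow_mem {F : ℤ → Submodule K H} {e : H →ₗ[K] H}
    (hmaps : ∀ n : ℤ, ∀ x ∈ F n, e x ∈ F (n + 2)) {k : ℕ}
    (hinj : Function.Injective (eBarPow F e hmaps k (-(k : ℤ)))) {v : H}
    (hv : v ∈ F (-(k : ℤ))) (hpow : (e ^ k) v ∈ F ((k : ℤ) - 1)) :
    v ∈ F (-(k : ℤ) - 1) := by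
  have hzero : eBarPow F e hmaps k (-(k : ℤ)) (Submodule.Quotient.mk ⟨v, hv⟩) = 0 := by
    refine (Submodule.Quotient.mk_eq_zero _).2 ?_
    change (e ^ k) v ∈ F (-(k : ℤ) + 2 * k - 1)
    rwa [show -(k : ℤ) + 2 * k - 1 = k - 1 by ring]
  have hmk := hinj (hzero.trans (map_zero _).symm)
  rw [Submodule.Quotient.mk_eq_zero] at hmk
  exact hmk

/-- in an HL-triple, if `v ∈ F_{-i-1}` and `e^s v ∈ F_{s-1}` for all `s > i`,
then `v = 0`. -/
theorem eq_zero_of_pow_mem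
    (F : ℤ → Submodule K H) (e : H →ₗ[K] H)
    (hmono : ∀ n : ℤ, F (n - 1) ≤ F n)
    (hfin : ∃ N : ℕ, (∀ n : ℤ, n ≤ -(N : ℤ) → F n = ⊥) ∧ (∀ n : ℤ, (N : ℤ) ≤ n → F n = ⊤))
    (hmaps : ∀ n : ℤ, ∀ x ∈ F n, e x ∈ F (n + 2))
    (hHL : ∀ i : ℕ, Function.Bijective (eBarPow F e hmaps i (-(i : ℤ))))
    (i : ℕ) (v : H) (hv : v ∈ F (-(i : ℤ) - 1))
    (hpow : ∀ s : ℕ, i < s → (e ^ s) v ∈ F ((s : ℤ) - 1)) :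
    v = 0 := by
  obtain ⟨N, hbot, -⟩ := hfin
  have hmem : ∀ j : ℕ, v ∈ F (-((i + 1 + j : ℕ) : ℤ)) := by
    intro j
    induction j with
    | zero => simpa [sub_eq_add_neg, add_comm] using hv
    | succ j ih =>
      have h := mem_sub_one_of_pow_mem hmaps (hHL _).injective ih (hpow _ (by lia))
      convert h using 2
      lia
  have h := hmem N
  rwa [hbot _ (by lia), Submodule.mem_bot] at h
end
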